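/- arXiv:2010.15580 — 2 statements merged into one kernel-verified Lean document; each statement's English description precedes it below -/
import Mathlib

section
/- For every integer n with log(log n) ≥ log 2 (i.e. n ≥ e^2), τ(n) < n^{log 2/log(log n) + 1/(log log n)² + 7/(log log n)³}. -/
open Finset Real

theorem five_mul_primeCounting_le {n : ℕ} (hn : 23 ≤ n) : 5 * Nat.primeCounting n ≤ 2 * n := by
  rcases le_or_gt 40 n with h | h
  · have h8 : Nat.primeCounting' 23 = 8 := by decide
    have h6 : Nat.totient 6 = 2 := by decide
    have := Nat.primeCounting'_add_le (a := 6) (k := 23) (by norm_num) (by norm_num) (n - 22)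
    rw [h8, h6, show 23 + (n - 22) = n + 1 by omega] at this
    rw [Nat.primeCounting]
    omega
  · interval_cases n <;> decide

theorem primeCounting_pow_le_primorial {n : ℕ} (hn : n ≤ 22) :
    (5 * n.primeCounting) ^ n.primeCounting * 100 ^ n.primeCounting ≤
      (2 * 271) ^ n.primeCounting * primorial n := by
  interval_cases n <;> decide

theorem primeCounting_mul_log_sub_le_theta_of_le {n : ℕ} (hn : n ≤ 22) :
    n.primeCounting * log (5 / 2 * n.primeCounting) - n.primeCounting ≤ Chebyshev.theta n := by
  have h := primeCounting_pow_le_primorial hn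
  rw [Chebyshev.theta_eq_log_primorial, Nat.floor_natCast]
  have hP : (0 : ℝ) < primorial n := mod_cast primorial_pos n
  rcases Nat.eq_zero_or_pos n.primeCounting with h0 | h0
  · rw [h0]
    simpa using log_nonneg (mod_cast primorial_pos n : (1 : ℝ) ≤ primorial n)
  set k := n.primeCounting
  have hk : (0 : ℝ) < k := mod_cast h0
  have h' : ((5 * k : ℝ)) ^ k * 100 ^ k ≤ (2 * 271) ^ k * primorial n := mod_cast h
  have h2 : (5 / 2 * k : ℝ) ^ k ≤ exp 1 ^ k * primorial n := by
    calc (5 / 2 * k : ℝ) ^ k = ((5 * k : ℝ) ^ k * 100 ^ k) / 200 ^ k := by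
          rw [← mul_pow, ← div_pow]; ring
      _ ≤ ((2 * 271) ^ k * primorial n) / 200 ^ k := by gcongr
      _ = (271 / 100) ^ k * primorial n := by
          rw [mul_div_right_comm, ← div_pow]; norm_num
      _ ≤ exp 1 ^ k * primorial n := by
          gcongr
          linarith [exp_one_gt_d9]
  have h3 := log_le_log (by positivity) h2
  rw [log_mul (by positivity) hP.ne', log_pow, log_pow, log_exp] at h3
  linarith

/-- A lower bound for `θ` in terms of the number of primes. -/
theorem primeCounting_mul_log_sub_le_theta (n : ℕ) :
    n.primeCounting * log (5 / 2 * n.primeCounting) - n.primeCounting ≤ Chebyshev.theta n := by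
  rcases le_or_gt n 22 with hn | hn
  · exact primeCounting_mul_log_sub_le_theta_of_le hn
  · obtain ⟨m, rfl⟩ : ∃ m, n = m + 22 := ⟨n - 22, by omega⟩
    clear hn
    induction m with
    | zero => exact primeCounting_mul_log_sub_le_theta_of_le le_rfl
    | succ m ih =>
      set N := m + 22 with hN
      rw [show m + 1 + 22 = N + 1 by omega]
      by_cases hp : (N + 1).Prime
      · have hc : (N + 1).primeCounting = N.primeCounting + 1 := by
          simp [Nat.primeCounting, Nat.primeCounting', Nat.count_succ, hp]
        have ht : Chebyshev.theta (N + 1 : ℕ) = log (N + 1 : ℕ) + Chebyshev.theta N := by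
          rw [Chebyshev.theta_eq_sum_primesLE_log, Chebyshev.theta_eq_sum_primesLE_log,
            Nat.primesLE_succ, if_pos hp, Finset.sum_insert]
          simp [Nat.mem_primesLE]
        have h5 := five_mul_primeCounting_le (n := N + 1) (by omega)
        rw [hc] at h5 ⊢
        have hk0 : 0 < N.primeCounting := Nat.pos_of_ne_zero fun h => by
          rw [Nat.primeCounting_eq_zero_iff] at h; omega
        rw [ht]
        set k := N.primeCounting
        have hk : (0 : ℝ) < k := mod_cast hk0
        have h5' : 5 / 2 * ((k : ℝ) + 1) ≤ (N + 1 : ℕ) := by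
          have : (5 * (k + 1) : ℝ) ≤ 2 * (N + 1 : ℕ) := mod_cast h5
          linarith
        have h1 := log_le_log (by positivity) h5'
        have h2 : log (5 / 2 * (k + 1)) - log (5 / 2 * k) ≤ 1 / k := by
          rw [← log_div (by positivity) (by positivity)]
          refine (log_le_sub_one_of_pos (by positivity)).trans (le_of_eq ?_)
          field_simp
          ring
        have h3 := mul_le_mul_of_nonneg_left h2 hk.le
        rw [mul_one_div_cancel hk.ne'] at h3
        push_cast at h1 ⊢
        linarith
      · have hc : (N + 1).primeCounting = N.primeCounting := by
          simp [Nat.primeCounting, Nat.primeCounting', Nat.count_succ, hp]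
        have ht : Chebyshev.theta (N + 1 : ℕ) = Chebyshev.theta N := by
          rw [Chebyshev.theta_eq_sum_primesLE_log, Chebyshev.theta_eq_sum_primesLE_log,
            Nat.primesLE_succ, if_neg hp]
        rw [hc, ht]
        exact ih

theorem sum_primesLE_sub_log_le {n : ℕ} (u : ℝ) :
    ∑ p ∈ n.primesLE, (u - log p) ≤ 2 / 5 * exp u := by
  rw [sum_sub_distrib, ← Chebyshev.theta_eq_sum_primesLE_log, sum_const,
    Nat.primesLE_card_eq_primeCounting, nsmul_eq_mul]
  have h := primeCounting_mul_log_sub_le_theta n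
  rcases Nat.eq_zero_or_pos n.primeCounting with h0 | h0
  · rw [h0] at h ⊢
    have := exp_pos u
    norm_num at h ⊢
    linarith
  set k := n.primeCounting
  have hk : (0 : ℝ) < k := mod_cast h0
  have h1 := add_one_le_exp (u - log (5 / 2 * k))
  rw [exp_sub, exp_log (by positivity)] at h1
  have h2 := mul_le_mul_of_nonneg_left h1 hk.le
  have h3 : (k : ℝ) * (exp u / (5 / 2 * k)) = 2 / 5 * exp u := by field_simp
  linarith

theorem sum_max_sub_log_le_sum_primesLE {s : Finset ℕ} (hs : ∀ p ∈ s, p.Prime) (u : ℝ) :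
    ∑ p ∈ s, max 0 (u - log p) ≤ ∑ p ∈ Nat.primesLE ⌊exp u⌋₊, (u - log p) := by
  have key {p : ℕ} (hp : p.Prime) : p ≤ ⌊exp u⌋₊ ↔ log p ≤ u := by
    rw [Nat.le_floor_iff (exp_pos u).le, log_le_iff_le_exp (mod_cast hp.pos)]
  calc ∑ p ∈ s, max 0 (u - log p)
      = ∑ p ∈ s with p ≤ ⌊exp u⌋₊, (u - log p) := by
        rw [sum_filter]
        refine sum_congr rfl fun p hp => ?_
        split_ifs with h
        · exact max_eq_right (sub_nonneg.2 ((key (hs p hp)).1 h))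
        · rw [key (hs p hp)] at h
          exact max_eq_left (by linarith)
    _ ≤ _ := by
        refine sum_le_sum_of_subset_of_nonneg (fun p hp => ?_) fun p hp _ => ?_
        · rw [mem_filter] at hp
          exact Nat.mem_primesLE.2 ⟨hp.2, hs p hp.1⟩
        · rw [Nat.mem_primesLE] at hp
          exact sub_nonneg.2 ((key hp.2).1 hp.1)

theorem sum_max_sub_log_le {s : Finset ℕ} (hs : ∀ p ∈ s, p.Prime) (u : ℝ) :
    ∑ p ∈ s, max 0 (u - log p) ≤ 2 / 5 * exp u :=
  (sum_max_sub_log_le_sum_primesLE hs u).trans (sum_primesLE_sub_log_le u)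

theorem log_add_one_eq_sum (a : ℕ) :
    log (a + 1) = ∑ k ∈ Icc 1 a, log ((k + 1) / k) := by
  induction a with
  | zero => simp
  | succ a ih =>
    rw [sum_Icc_succ_top (by omega), ← ih, ← log_mul (by positivity) (by positivity)]
    congr 1
    push_cast
    field_simp

theorem log_add_one_sub_le_sum_max {t : ℝ} {K : ℕ} (hK : 1 ≤ K * t) (a : ℕ) :
    log (a + 1) - a * t ≤ ∑ k ∈ Icc 1 K, max 0 (log ((k + 1) / k) - t) := by
  calc log (a + 1) - a * t = ∑ k ∈ Icc 1 a, (log ((k + 1) / k) - t) := by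
        rw [sum_sub_distrib, ← log_add_one_eq_sum]; simp
    _ ≤ ∑ k ∈ Icc 1 a with k ≤ K, max 0 (log (((k : ℝ) + 1) / k) - t) := by
        rw [sum_filter]
        refine sum_le_sum fun k hk => ?_
        have hk0 : (0 : ℝ) < k := mod_cast (mem_Icc.1 hk).1
        split_ifs with h
        · exact le_max_right _ _
        · have h1 : (K : ℝ) ≤ k := mod_cast (not_le.1 h).le
          have h2 : log (((k : ℝ) + 1) / k) ≤ 1 / k := by
            refine (log_le_sub_one_of_pos (by positivity)).trans (le_of_eq ?_)
            field_simp
            ring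
          have ht : 0 < t := by
            by_contra! ht
            nlinarith [mul_nonneg (Nat.cast_nonneg (α := ℝ) K) (neg_nonneg.2 ht)]
          have h3 : 1 / (k : ℝ) ≤ t := by
            rw [div_le_iff₀ hk0]
            nlinarith
          linarith
    _ ≤ _ := by
        refine sum_le_sum_of_subset_of_nonneg (fun k hk => ?_) fun _ _ _ => le_max_left _ _
        simp only [mem_filter, mem_Icc] at hk ⊢
        omega

theorem log_card_divisors_sub_le {n : ℕ} (hn : n ≠ 0) {m : ℝ} (hm : 0 < m) {K : ℕ}
    (hK : m ≤ K * log 2) :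
    m * log n.divisors.card - log n ≤
      ∑ k ∈ Icc 1 K, ∑ p ∈ n.primeFactors, max 0 (m * log ((k + 1) / k) - log p) := by
  have h1 : log n.divisors.card = ∑ p ∈ n.primeFactors, log (n.factorization p + 1) := by
    rw [Nat.card_divisors hn, Nat.cast_prod, log_prod fun p _ => by positivity]
    push_cast
    rfl
  have h2 : log n = ∑ p ∈ n.primeFactors, n.factorization p * log p := by
    conv_lhs => rw [← Nat.prod_factorization_pow_eq_self hn]
    rw [Nat.prod_factorization_eq_prod_primeFactors, Nat.cast_prod, log_prod fun p hp => by
      have := (Nat.prime_of_mem_primeFactors hp).ne_zero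
      positivity]
    refine sum_congr rfl fun p _ => ?_
    rw [Nat.cast_pow, log_pow]
  rw [h1, h2, mul_sum, ← sum_sub_distrib, sum_comm]
  refine sum_le_sum fun p hp => ?_
  have hp2 : log 2 ≤ log p :=
    log_le_log two_pos (mod_cast (Nat.prime_of_mem_primeFactors hp).two_le)
  have hK' : 1 ≤ K * (log p / m) := by
    rw [← mul_div_assoc, one_le_div hm]
    exact hK.trans (by gcongr)
  have h3 := mul_le_mul_of_nonneg_left
    (log_add_one_sub_le_sum_max hK' (n.factorization p)) hm.le
  rw [mul_sum] at h3
  calc m * log (n.factorization p + 1) - n.factorization p * log p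
      = m * (log (n.factorization p + 1) - n.factorization p * (log p / m)) := by field_simp
    _ ≤ _ := h3
    _ = _ := by
      refine sum_congr rfl fun k _ => ?_
      rw [mul_max_of_nonneg _ _ hm.le, mul_zero, mul_sub, mul_div_cancel₀ _ hm.ne']

theorem mul_log_card_divisors_sub_le {n : ℕ} (hn : n ≠ 0) {m : ℝ} (hm : 0 < m) :
    m * log n.divisors.card - log n ≤
      ∑ p ∈ n.primeFactors, max 0 (m * log 2 - log p) +
        2 / 5 * (exp (m * log (3 / 2)) + exp (m * log (4 / 3)) +
          m / log 2 * exp (m * log (5 / 4))) := by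
  have hl : 0 < log 2 := log_pos one_lt_two
  have hfl := Nat.lt_floor_add_one (m / log 2)
  have hfl' := Nat.floor_le (div_pos hm hl).le
  set N := ⌊m / log 2⌋₊
  have hK : m ≤ (N + 3 : ℕ) * log 2 := by
    rw [div_lt_iff₀ hl] at hfl
    push_cast
    nlinarith
  refine (log_card_divisors_sub_le hn hm hK).trans ?_
  have hs : ∀ p ∈ n.primeFactors, p.Prime := fun p hp => Nat.prime_of_mem_primeFactors hp
  have hsplit : Icc 1 (N + 3) = insert 1 (insert 2 (insert 3 (Icc 4 (N + 3)))) := by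
    ext k
    simp only [mem_Icc, mem_insert]
    omega
  rw [hsplit, sum_insert (by simp), sum_insert (by simp), sum_insert (by simp)]
  have h2 := sum_max_sub_log_le hs (m * log (3 / 2))
  have h3 := sum_max_sub_log_le hs (m * log (4 / 3))
  have h4 : ∑ k ∈ Icc 4 (N + 3), ∑ p ∈ n.primeFactors, max 0 (m * log ((k + 1) / k) - log p) ≤
      m / log 2 * (2 / 5 * exp (m * log (5 / 4))) := by
    calc _ ≤ ∑ k ∈ Icc 4 (N + 3), 2 / 5 * exp (m * log (5 / 4)) := by
          refine sum_le_sum fun k hk => (sum_max_sub_log_le hs _).trans ?_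
          have hk4 : (4 : ℝ) ≤ k := mod_cast (mem_Icc.1 hk).1
          have : ((k : ℝ) + 1) / k ≤ 5 / 4 := by
            rw [div_le_div_iff₀ (by linarith) (by norm_num)]
            linarith
          gcongr
      _ = N * (2 / 5 * exp (m * log (5 / 4))) := by
          rw [sum_const, Nat.card_Icc, nsmul_eq_mul]
          congr
      _ ≤ _ := by gcongr
  norm_num at h2 h3 h4 ⊢
  linarith

/-- A primitive of an upper bound for `1 / log t ^ 2`. -/
theorem hasDerivAt_mul_inv_log_sq_add (c : ℝ) {t : ℝ} (ht : 1 < t) :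
    HasDerivAt (fun t => t * ((log t)⁻¹ ^ 2 + c * (log t)⁻¹ ^ 3))
      ((log t)⁻¹ ^ 2 + (c - 2) * (log t)⁻¹ ^ 3 - 3 * c * (log t)⁻¹ ^ 4) t := by
  have hl : log t ≠ 0 := (log_pos ht).ne'
  have ht0 : t ≠ 0 := by linarith
  have h := (hasDerivAt_log ht0).inv hl
  have h' := (hasDerivAt_id t).mul ((h.pow 2).add ((h.pow 3).const_mul c))
  refine h'.congr_deriv ?_
  simp
  field_simp
  ring

theorem integral_theta_div_le {c a b : ℝ} (ha : 2 ≤ a) (hab : a ≤ b)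
    (hc : 3 * c ≤ (c - 2) * log a) (hc2 : 2 ≤ c) :
    ∫ t in a..b, Chebyshev.theta t / (t * log t ^ 2) ≤
      log 4 * (b * ((log b)⁻¹ ^ 2 + c * (log b)⁻¹ ^ 3)) -
        log 4 * (a * ((log a)⁻¹ ^ 2 + c * (log a)⁻¹ ^ 3)) := by
  have hder (t : ℝ) (ht : a ≤ t) := (hasDerivAt_mul_inv_log_sq_add c
    (by linarith : 1 < t)).const_mul (log 4)
  refine intervalIntegral.integral_le_sub_of_hasDeriv_right_of_le hab
    (fun t ht => (hder t ht.1).continuousAt.continuousWithinAt)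
    (fun t ht => (hder t ht.1.le).hasDerivWithinAt)
    ((Chebyshev.integrableOn_theta_div_id_mul_log_sq b).mono_set (Set.Icc_subset_Icc_left ha))
    fun t ht => ?_
  have ht2 : 2 ≤ t := ha.trans ht.1.le
  have hl : 0 < log t := log_pos (by linarith)
  have hla : log a ≤ log t := log_le_log (by linarith) ht.1.le
  have hth := Chebyshev.theta_le_log4_mul_x (by linarith : 0 ≤ t)
  calc Chebyshev.theta t / (t * log t ^ 2) ≤ log 4 * t / (t * log t ^ 2) := by gcongr
    _ = log 4 * (log t)⁻¹ ^ 2 := by field_simp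
    _ ≤ _ := by
      gcongr
      have : 0 ≤ ((c - 2) * log t - 3 * c) * (log t)⁻¹ ^ 4 := by
        have := mul_le_mul_of_nonneg_left hla (sub_nonneg.2 hc2)
        have : 0 ≤ (c - 2) * log t - 3 * c := by linarith
        positivity
      have h2 : ((c - 2) * log t - 3 * c) * (log t)⁻¹ ^ 4 =
          (c - 2) * (log t)⁻¹ ^ 3 - 3 * c * (log t)⁻¹ ^ 4 := by field_simp
      linarith

theorem sum_primesLE_sub_log_eq {x : ℝ} (hx : 2 ≤ x) :
    ∑ p ∈ Nat.primesLE ⌊x⌋₊, (log x - log p) =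
      log x * ∫ t in 2..x, Chebyshev.theta t / (t * log t ^ 2) := by
  have hl : log x ≠ 0 := (log_pos (by linarith)).ne'
  rw [sum_sub_distrib, ← Chebyshev.theta_eq_sum_primesLE, sum_const,
    Nat.primesLE_card_eq_primeCounting, nsmul_eq_mul,
    Chebyshev.primeCounting_eq_theta_div_log_add_integral hx]
  field_simp
  ring

theorem sum_max_sub_log_le_of_eight_le {s : Finset ℕ} (hs : ∀ p ∈ s, p.Prime) {m : ℝ}
    (hm : 8 ≤ m) :
    ∑ p ∈ s, max 0 (m * log 2 - log p) ≤
      exp (m * log 2) * (2 / m + 2 * (109 / 25) * (log 2)⁻¹ / m ^ 2) -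
        (109 / 25 * (log 2)⁻¹ - 24 / 5) * m := by
  refine (sum_max_sub_log_le_sum_primesLE hs _).trans ?_
  have hl := log_two_gt_d9
  have hl0 : 0 < log 2 := by linarith
  have h256 : log 256 = 8 * log 2 := by
    rw [show (256 : ℝ) = 2 ^ 8 by norm_num, log_pow]
    norm_num
  have h4 : log 4 = 2 * log 2 := by
    rw [show (4 : ℝ) = 2 ^ 2 by norm_num, log_pow]
    norm_num
  have hx : 256 ≤ exp (m * log 2) := by
    rw [← log_le_iff_le_exp (by norm_num), h256]
    gcongr
  have h := sum_primesLE_sub_log_eq (x := exp (m * log 2)) (by linarith)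
  rw [log_exp] at h
  rw [h]
  have hint {a b : ℝ} (ha : 2 ≤ a) (hab : a ≤ b) :
      IntervalIntegrable (fun t => Chebyshev.theta t / (t * log t ^ 2)) MeasureTheory.volume a b :=
    (intervalIntegrable_iff_integrableOn_Icc_of_le hab).2
      ((Chebyshev.integrableOn_theta_div_id_mul_log_sq b).mono_set (Set.Icc_subset_Icc_left ha))
  rw [← intervalIntegral.integral_add_adjacent_intervals (b := 256)
    (hint le_rfl (by norm_num)) (hint (by norm_num) hx)]
  have h1 := sum_primesLE_sub_log_le (n := ⌊(256 : ℝ)⌋₊) (log 256)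
  rw [sum_primesLE_sub_log_eq (by norm_num), exp_log (by norm_num), h256] at h1
  have h2 := integral_theta_div_le (c := 109 / 25) (by norm_num) hx
    (by rw [h256]; linarith) (by norm_num)
  rw [log_exp, h256, h4] at h2
  set I := ∫ t in 2..256, Chebyshev.theta t / (t * log t ^ 2)
  set J := ∫ t in 256..exp (m * log 2), Chebyshev.theta t / (t * log t ^ 2)
  have hI : log 2 * I ≤ 64 / 5 := by linarith
  have hm0 : 0 < m := by linarith
  have hI' := mul_le_mul_of_nonneg_left hI hm0.le
  have hJ' := mul_le_mul_of_nonneg_left h2 (mul_pos hm0 hl0).le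
  calc m * log 2 * (I + J) = m * (log 2 * I) + m * log 2 * J := by ring
    _ ≤ _ := add_le_add hI' hJ'
    _ = _ := by
      field_simp
      ring

theorem pow_mul_exp_neg_le_of_le {a m s : ℝ} {n : ℕ} (ha : 0 < a) (hm : a ≤ m)
    (hs : n ≤ s * a) : m ^ n * exp (-(m * s)) ≤ a ^ n * exp (-(a * s)) := by
  have hm0 : 0 < m := by linarith
  have h1 : m / a ≤ exp (m / a - 1) := by linarith [add_one_le_exp (m / a - 1)]
  have h2 : (m / a) ^ n ≤ exp (n * (m / a - 1)) := by
    rw [exp_nat_mul]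
    gcongr
  calc m ^ n * exp (-(m * s)) = a ^ n * ((m / a) ^ n * exp (-(m * s))) := by
        rw [div_pow]; field_simp
    _ ≤ a ^ n * (exp (n * (m / a - 1)) * exp (-(m * s))) := by gcongr
    _ ≤ a ^ n * exp (-(a * s)) := by
      rw [← exp_add]
      gcongr
      have : 0 ≤ m / a - 1 := by rw [sub_nonneg, one_le_div ha]; exact hm
      have := mul_le_mul_of_nonneg_right hs this
      have h3 : s * a * (m / a - 1) = m * s - a * s := by field_simp
      linarith

theorem pow_mul_exp_neg_le {a m s : ℝ} {n : ℕ} (ha : 0 < a) (hm : 0 ≤ m)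
    (hs : n ≤ s * a) : m ^ n * exp (-(m * s)) ≤ a ^ n * exp (-n) := by
  have h1 : m / a ≤ exp (m / a - 1) := by linarith [add_one_le_exp (m / a - 1)]
  have h2 : (m / a) ^ n ≤ exp (n * (m / a - 1)) := by
    rw [exp_nat_mul]
    gcongr
  calc m ^ n * exp (-(m * s)) = a ^ n * ((m / a) ^ n * exp (-(m * s))) := by
        rw [div_pow]; field_simp
    _ ≤ a ^ n * (exp (n * (m / a - 1)) * exp (-(m * s))) := by gcongr
    _ ≤ a ^ n * exp (-n) := by
      rw [← exp_add]
      gcongr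
      have := mul_le_mul_of_nonneg_right hs (div_nonneg hm ha.le)
      have h3 : s * a * (m / a) = m * s := by field_simp
      linarith

theorem exp_neg_natCast_mul_log {r : ℝ} (hr : 0 < r) (k : ℕ) :
    exp (-(k * log r)) = r⁻¹ ^ k := by
  rw [exp_neg, exp_nat_mul, exp_log hr, inv_pow]

theorem two_sevenths_le_log_four_thirds : 2 / 7 ≤ log (4 / 3) := by
  have h : (2 : ℕ) ≤ log ((4 / 3) ^ 7) := by
    rw [le_log_iff_exp_le (by norm_num), ← exp_one_pow]
    exact (pow_le_pow_left₀ (exp_pos 1).le exp_one_lt_d9.le 2).trans (by norm_num)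
  rw [log_pow] at h
  norm_num at h
  linarith

theorem two_fifths_le_log_three_halves : 2 / 5 ≤ log (3 / 2) := by
  have h : (2 : ℕ) ≤ log ((3 / 2) ^ 5) := by
    rw [le_log_iff_exp_le (by norm_num), ← exp_one_pow]
    exact (pow_le_pow_left₀ (exp_pos 1).le exp_one_lt_d9.le 2).trans (by norm_num)
  rw [log_pow] at h
  norm_num at h
  linarith

theorem seven_fifteenths_le_log_eight_fifths : 7 / 15 ≤ log (8 / 5) := by
  have h : (7 : ℕ) ≤ log ((8 / 5) ^ 15) := by
    rw [le_log_iff_exp_le (by norm_num), ← exp_one_pow]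
    exact (pow_le_pow_left₀ (exp_pos 1).le exp_one_lt_d9.le 7).trans (by norm_num)
  rw [log_pow] at h
  norm_num at h
  linarith

theorem inv_log_two_mem_Ioo : (log 2)⁻¹ ∈ Set.Ioo (1.442695 : ℝ) 1.442696 := by
  have h1 := log_two_gt_d9
  have h2 := log_two_lt_d9
  have h0 : 0 < log 2 := by linarith
  rw [Set.mem_Ioo, lt_inv_comm₀ (by norm_num) h0, inv_lt_comm₀ h0 (by norm_num)]
  constructor <;> norm_num at * <;> linarith

theorem layers_lt_of_le_eight {m : ℝ} (hm : 0 ≤ m) (hm8 : m ≤ 8) :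
    2 / 5 * (m ^ 2 + m ^ 2 * exp (-(m * log (4 / 3))) + m ^ 2 * exp (-(m * log (3 / 2))) +
      (log 2)⁻¹ * (m ^ 3 * exp (-(m * log (8 / 5))))) <
      (log 2)⁻¹ ^ 2 * m + 7 * (log 2)⁻¹ ^ 3 := by
  obtain ⟨hw1, hw2⟩ := inv_log_two_mem_Ioo
  set w := (log 2)⁻¹
  have hP := pow_mul_exp_neg_le (a := 7) (n := 2) (by norm_num) hm
    (by push_cast; linarith [two_sevenths_le_log_four_thirds] : (2 : ℕ) ≤ log (4 / 3) * 7)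
  have hQ := pow_mul_exp_neg_le (a := 5) (n := 2) (by norm_num) hm
    (by push_cast; linarith [two_fifths_le_log_three_halves] : (2 : ℕ) ≤ log (3 / 2) * 5)
  have hR := pow_mul_exp_neg_le (a := 45 / 7) (n := 3) (by norm_num) hm
    (by push_cast; linarith [seven_fifteenths_le_log_eight_fifths] :
      (3 : ℕ) ≤ log (8 / 5) * (45 / 7))
  have hE (k : ℕ) : exp (-k) ≤ (1 / 2.7182818) ^ k := by
    rw [exp_neg, ← exp_one_pow, one_div, inv_pow]
    gcongr
    linarith [exp_one_gt_d9]
  have hP' := hP.trans (mul_le_mul_of_nonneg_left (hE 2) (by norm_num))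
  have hQ' := hQ.trans (mul_le_mul_of_nonneg_left (hE 2) (by norm_num))
  have hR' := hR.trans (mul_le_mul_of_nonneg_left (hE 3) (by norm_num))
  have hw2' : (1.442695 : ℝ) ^ 2 ≤ w ^ 2 := by gcongr
  have hw3' : (1.442695 : ℝ) ^ 3 ≤ w ^ 3 := by gcongr
  have hm2 : m ^ 2 ≤ 8 * m := by nlinarith
  have h1 := mul_le_mul_of_nonneg_right hw2' hm
  have h2 : w * (m ^ 3 * exp (-(m * log (8 / 5)))) ≤ 1.442696 * _ :=
    mul_le_mul hw2.le hR' (by positivity) (by norm_num)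
  norm_num at *
  linarith

theorem layers_lt_of_eight_le {m : ℝ} (hm : 8 ≤ m) :
    2 / 5 * (m ^ 2 * exp (-(m * log (4 / 3))) + m ^ 2 * exp (-(m * log (3 / 2))) +
      (log 2)⁻¹ * (m ^ 3 * exp (-(m * log (8 / 5))))) <
      ((log 2)⁻¹ ^ 2 - 2) * m + 7 * (log 2)⁻¹ ^ 3 - 2 * (109 / 25) * (log 2)⁻¹ +
        (109 / 25 * (log 2)⁻¹ - 24 / 5) * (m ^ 3 * exp (-(m * log 2))) := by
  obtain ⟨hw1, hw2⟩ := inv_log_two_mem_Ioo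
  set w := (log 2)⁻¹
  have hw2' : (1.442695 : ℝ) ^ 2 ≤ w ^ 2 := by gcongr
  have hw3' : (1.442695 : ℝ) ^ 3 ≤ w ^ 3 := by gcongr
  have upper (a : ℕ) (ha : 8 ≤ a) (ham : a ≤ m) :
      m ^ 2 * exp (-(m * log (4 / 3))) + m ^ 2 * exp (-(m * log (3 / 2))) +
        w * (m ^ 3 * exp (-(m * log (8 / 5)))) ≤
      a ^ 2 * (3 / 4) ^ a + a ^ 2 * (2 / 3) ^ a + 1.442696 * (a ^ 3 * (5 / 8) ^ a) := by
    have ha' : (8 : ℝ) ≤ a := mod_cast ha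
    have ha0 : (0 : ℝ) < a := by linarith
    have hP := pow_mul_exp_neg_le_of_le (n := 2) (s := log (4 / 3)) ha0 ham
      (by push_cast; nlinarith [two_sevenths_le_log_four_thirds])
    have hQ := pow_mul_exp_neg_le_of_le (n := 2) (s := log (3 / 2)) ha0 ham
      (by push_cast; nlinarith [two_fifths_le_log_three_halves])
    have hR := pow_mul_exp_neg_le_of_le (n := 3) (s := log (8 / 5)) ha0 ham
      (by push_cast; nlinarith [seven_fifteenths_le_log_eight_fifths])
    rw [exp_neg_natCast_mul_log (by norm_num)] at hP hQ hR
    have h2 : w * (m ^ 3 * exp (-(m * log (8 / 5)))) ≤ 1.442696 * _ :=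
      mul_le_mul hw2.le hR (by positivity) (by norm_num)
    norm_num at hP hQ h2 ⊢
    linarith
  have lower (b : ℕ) (hb : m ≤ b) : 1.49 * (b ^ 3 * (1 / 2) ^ b) ≤
      (109 / 25 * w - 24 / 5) * (m ^ 3 * exp (-(m * log 2))) := by
    have h := pow_mul_exp_neg_le_of_le (n := 3) (s := log 2) (by linarith) hb
      (by push_cast; nlinarith [log_two_gt_d9])
    rw [exp_neg_natCast_mul_log (by norm_num)] at h
    rw [one_div]
    exact mul_le_mul (by linarith) h (by positivity) (by linarith)
  have hmw : (1.442695 ^ 2 - 2) * m ≤ (w ^ 2 - 2) * m := by gcongr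
  rcases le_total m 9 with h9 | h9
  · have h1 := upper 8 le_rfl (mod_cast hm)
    have h2 := lower 9 (mod_cast h9)
    norm_num at h1 h2 hw3' hmw hw2 ⊢
    linarith
  rcases le_total m 10 with h10 | h10
  · have h1 := upper 9 (by norm_num) (mod_cast h9)
    have h2 := lower 10 (mod_cast h10)
    norm_num at h1 h2 hw3' hmw hw2 ⊢
    linarith
  · have h1 := upper 10 (by norm_num) (mod_cast h10)
    have h2 : 0 ≤ (109 / 25 * w - 24 / 5) * (m ^ 3 * exp (-(m * log 2))) :=
      mul_nonneg (by linarith) (by positivity)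
    norm_num at h1 h2 hw3' hmw hw2 ⊢
    linarith

theorem mul_log_card_divisors_lt {n : ℕ} (hn : n ≠ 0) {m : ℝ} (hm : 0 < m) :
    m * log n.divisors.card - log n <
      exp (m * log 2) * ((log 2)⁻¹ ^ 2 / m + 7 * (log 2)⁻¹ ^ 3 / m ^ 2) := by
  refine (mul_log_card_divisors_sub_le hn hm).trans_lt ?_
  have hs : ∀ p ∈ n.primeFactors, p.Prime := fun p hp => Nat.prime_of_mem_primeFactors hp
  have e1 : exp (m * log (3 / 2)) = exp (m * log 2) * exp (-(m * log (4 / 3))) := by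
    rw [← exp_add, ← mul_neg, ← mul_add, ← sub_eq_add_neg,
      ← log_div two_ne_zero (by norm_num)]
    norm_num
  have e2 : exp (m * log (4 / 3)) = exp (m * log 2) * exp (-(m * log (3 / 2))) := by
    rw [← exp_add, ← mul_neg, ← mul_add, ← sub_eq_add_neg,
      ← log_div two_ne_zero (by norm_num)]
    norm_num
  have e3 : exp (m * log (5 / 4)) = exp (m * log 2) * exp (-(m * log (8 / 5))) := by
    rw [← exp_add, ← mul_neg, ← mul_add, ← sub_eq_add_neg,
      ← log_div two_ne_zero (by norm_num)]
    norm_num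
  have e4 : exp (m * log 2) * exp (-(m * log 2)) = 1 := by rw [← exp_add]; simp
  rw [e1, e2, e3, div_eq_mul_inv m]
  set E := exp (m * log 2)
  have hE : 0 < E := exp_pos _
  have hEm : 0 < E / m ^ 2 := by positivity
  rcases le_total m 8 with h8 | h8
  · have h1 := sum_max_sub_log_le hs (m * log 2)
    have h2 := mul_lt_mul_of_pos_left (layers_lt_of_le_eight hm.le h8) hEm
    calc _ ≤ E / m ^ 2 * (2 / 5 * (m ^ 2 + m ^ 2 * exp (-(m * log (4 / 3))) +
          m ^ 2 * exp (-(m * log (3 / 2))) +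
          (log 2)⁻¹ * (m ^ 3 * exp (-(m * log (8 / 5)))))) := by
          refine (add_le_add_left h1 _).trans (le_of_eq ?_)
          field_simp
          ring
      _ < _ := h2
      _ = _ := by
          field_simp
  · have h1 := sum_max_sub_log_le_of_eight_le hs h8
    have h2 := mul_lt_mul_of_pos_left (layers_lt_of_eight_le h8) hEm
    set d := exp (-(m * log 2))
    have hd : d = E⁻¹ := exp_neg _
    rw [hd] at h2
    refine (add_le_add_left h1 _).trans_lt ?_
    refine lt_of_eq_of_lt ?_ ((add_lt_add_iff_left (E / m ^ 2 * (2 * m + 2 * (109 / 25) *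
      (log 2)⁻¹ - (109 / 25 * (log 2)⁻¹ - 24 / 5) * (m ^ 3 * E⁻¹)))).2 h2 |>.trans_eq ?_)
    · field_simp
      ring
    · field_simp
      ring

theorem tau_psi_bound (n : ℕ) (hn : Real.log 2 ≤ Real.log (Real.log n)) :
    (n.divisors.card : ℝ) <
      (n : ℝ) ^ (Real.log 2 / Real.log (Real.log n)
        + 1 / (Real.log (Real.log n)) ^ 2 + 7 / (Real.log (Real.log n)) ^ 3) := by
  have hl : 0 < log 2 := log_pos one_lt_two
  have hn0 : n ≠ 0 := by
    rintro rfl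
    simp at hn
    linarith
  have hL : 0 < log (log n) := hl.trans_le hn
  have hlog : 0 < log n := (log_natCast_nonneg n).lt_of_ne fun h => by simp [← h] at hL
  rw [lt_rpow_iff_log_lt (mod_cast card_pos.2 (Nat.nonempty_divisors.2 hn0)) (by positivity)]
  have h := mul_log_card_divisors_lt hn0 (div_pos hL hl)
  rw [div_mul_cancel₀ _ hl.ne', exp_log hlog] at h
  set L := log (log n)
  have h2 : L / log 2 * log n.divisors.card <
      L / log 2 * ((log 2 / L + 1 / L ^ 2 + 7 / L ^ 3) * log n) := by
    refine (sub_lt_iff_lt_add.1 h).trans_eq ?_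
    field_simp
    ring
  exact lt_of_mul_lt_mul_left h2 (by positivity)
end

section
/- For every positive integer n ≥ 1375078, there exist an integer x with 0 ≤ x ≤ √n, gcd(x, n) = 1, such that n - x² is squarefree; moreover the count r*(n) of such x is positive, as follows from the bound ⌊√n⌋ - r*(n) < √n·(0.9045 + 2/log n + 6/(log n)²) + 12√2·n^{1/4}/log n valid for n ≥ 21. -/
open Finset

theorem card_le_of_residues {A : Finset ℕ} {J m t : ℕ} (hA : A ⊆ range J)
    (ht : (A.image (· % m)).card ≤ t) : A.card ≤ t * (J / m + 1) := by
  have h := card_le_mul_card_image (s := A) (f := (· % m)) (J / m + 1) (by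
    intro b _
    calc (A.filter (fun a => a % m = b)).card
        ≤ (range (J / m + 1)).card := by
          refine card_le_card_of_injOn (· / m) ?_ ?_
          · intro a ha
            have ha' := mem_range.1 (hA (mem_filter.1 ha).1)
            simp only [coe_range, Set.mem_Iio]
            exact Nat.lt_succ_of_le (Nat.div_le_div_right ha'.le)
          · intro a ha c hc hac
            have h1 := (mem_filter.1 (mem_coe.1 ha)).2
            have h2 := (mem_filter.1 (mem_coe.1 hc)).2
            simp only at hac
            rw [← Nat.div_add_mod a m, ← Nat.div_add_mod c m, hac, h1, h2]
      _ = _ := card_range _)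
  calc A.card ≤ (J / m + 1) * (A.image (· % m)).card := h
    _ ≤ (J / m + 1) * t := Nat.mul_le_mul_left _ ht
    _ = _ := mul_comm _ _

theorem card_progression_dvd_le {A : Finset ℕ} {J W q a : ℕ} (hA : A ⊆ range J)
    (hqW : q.Coprime W) (h : ∀ j ∈ A, q ∣ a + W * j) : A.card ≤ J / q + 1 := by
  have := card_le_of_residues (t := 1) hA (by
    rw [card_le_one]
    simp only [mem_image]
    rintro _ ⟨i, hi, rfl⟩ _ ⟨j, hj, rfl⟩
    have h1 : a + W * i ≡ a + W * j [MOD q] :=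
      ((Nat.modEq_zero_iff_dvd.2 (h i hi))).trans (Nat.modEq_zero_iff_dvd.2 (h j hj)).symm
    exact Nat.ModEq.cancel_left_of_coprime hqW (Nat.ModEq.add_left_cancel' a h1))
  simpa using this

theorem sq_dvd_sub_or_add {n p x z : ℕ} (hp : p.Prime) (h2 : p ≠ 2) (hpn : ¬ p ∣ n)
    (hx : x ^ 2 ≤ n) (hz : z ^ 2 ≤ n) (hpx : p ^ 2 ∣ n - x ^ 2) (hpz : p ^ 2 ∣ n - z ^ 2) :
    (p : ℤ) ^ 2 ∣ (x : ℤ) - z ∨ (p : ℤ) ^ 2 ∣ (x : ℤ) + z := by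
  have hx' : (p : ℤ) ^ 2 ∣ (n : ℤ) - x ^ 2 := by
    have := Int.natCast_dvd_natCast.2 hpx
    rw [Nat.cast_sub hx] at this; exact_mod_cast this
  have hz' : (p : ℤ) ^ 2 ∣ (n : ℤ) - z ^ 2 := by
    have := Int.natCast_dvd_natCast.2 hpz
    rw [Nat.cast_sub hz] at this; exact_mod_cast this
  have hd : (p : ℤ) ^ 2 ∣ ((x : ℤ) - z) * (x + z) := by
    have := dvd_sub hz' hx'
    have e : ((x : ℤ) - z) * (x + z) = (n : ℤ) - z ^ 2 - ((n : ℤ) - x ^ 2) := by ring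
    rwa [e]
  have hpi : Prime (p : ℤ) := Nat.prime_iff_prime_int.1 hp
  by_cases h : (p : ℤ) ∣ (x : ℤ) - z
  · left
    refine (IsCoprime.pow_left (m := 2) ?_).dvd_of_dvd_mul_right hd
    rw [Prime.coprime_iff_not_dvd hpi]
    intro h'
    have h3 : (p : ℤ) ∣ 2 * x := by
      have := dvd_add h h'; ring_nf at this; rwa [mul_comm]
    rcases hpi.dvd_or_dvd h3 with h4 | h4
    · have : p ∣ 2 := by exact_mod_cast h4
      exact h2 ((Nat.prime_dvd_prime_iff_eq hp Nat.prime_two).1 this)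
    · apply hpn
      have h5 : (p : ℤ) ∣ (n : ℤ) - x ^ 2 := (dvd_pow_self _ two_ne_zero).trans hx'
      have := dvd_add h5 (h4.trans (dvd_pow_self _ two_ne_zero))
      simp only [sub_add_cancel] at this
      exact_mod_cast this
  · right
    refine (IsCoprime.pow_left (m := 2) ?_).dvd_of_dvd_mul_left hd
    rwa [Prime.coprime_iff_not_dvd hpi]

theorem card_progression_sq_dvd_le {A : Finset ℕ} {J W l a n : ℕ} (hA : A ⊆ range J)
    (hl : l.Prime) (h2 : l ≠ 2) (hln : ¬ l ∣ n) (hlW : l.Coprime W)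
    (h : ∀ j ∈ A, (a + W * j) ^ 2 ≤ n ∧ l ^ 2 ∣ n - (a + W * j) ^ 2) :
    A.card ≤ 2 * (J / l ^ 2 + 1) := by
  refine card_le_of_residues hA ?_
  by_contra! hc
  rw [two_lt_card] at hc
  obtain ⟨u, hu, v, hv, w, hw, huv, huw, hvw⟩ := hc
  simp only [mem_image] at hu hv hw
  obtain ⟨i, hi, rfl⟩ := hu
  obtain ⟨j, hj, rfl⟩ := hv
  obtain ⟨k, hk, rfl⟩ := hw
  have key : ∀ i j : ℕ, i % l ^ 2 ≠ j % l ^ 2 →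
      ¬ ((l : ℤ) ^ 2 ∣ ((a + W * i : ℕ) : ℤ) - ((a + W * j : ℕ) : ℤ)) := by
    intro i j hij hd
    apply hij
    have h1 : (a + W * j) ≡ (a + W * i) [MOD l ^ 2] := by
      rw [Nat.modEq_iff_dvd]; exact_mod_cast hd
    exact (Nat.ModEq.cancel_left_of_coprime (Nat.Coprime.pow_left 2 hlW)
      (Nat.ModEq.add_left_cancel' a h1)).symm
  have hadd : ∀ i ∈ A, ∀ j ∈ A, i % l ^ 2 ≠ j % l ^ 2 →
      ((l : ℤ) ^ 2 ∣ ((a + W * i : ℕ) : ℤ) + ((a + W * j : ℕ) : ℤ)) := fun i hi j hj hij =>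
    (sq_dvd_sub_or_add hl h2 hln (h i hi).1 (h j hj).1 (h i hi).2 (h j hj).2).resolve_left
      (key i j hij)
  have e := dvd_sub (hadd i hi j hj huv) (hadd k hk j hj (Ne.symm hvw))
  rw [add_sub_add_right_eq_sub] at e
  exact key i k huw e

theorem card_large_prime_le {A : Finset ℕ} {n p M : ℕ} (hp : p.Prime) (h2 : p ≠ 2)
    (hpn : ¬ p ∣ n) (hM : ∀ x ∈ A, x ≤ M) (hpar : ∀ x ∈ A, x % 2 ≠ n % 2)
    (h : ∀ x ∈ A, x ^ 2 ≤ n ∧ p ^ 2 ∣ n - x ^ 2) : A.card ≤ M / p ^ 2 + 1 := by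
  have hpp : 0 < p ^ 2 := pow_pos hp.pos 2
  rw [← card_range (M / p ^ 2 + 1)]
  refine card_le_card_of_injOn (· / p ^ 2) ?_ ?_
  · intro x hx
    simp only [coe_range, Set.mem_Iio]
    exact Nat.lt_succ_of_le (Nat.div_le_div_right (hM x hx))
  · intro x hx z hz hxz
    simp only at hxz
    have hx0 := mem_coe.1 hx
    have hz0 := mem_coe.1 hz
    have hodd : Nat.Coprime (p ^ 2) 2 := by
      apply Nat.Coprime.pow_left
      exact (Nat.coprime_primes hp Nat.prime_two).2 h2
    have hpz : (p : ℤ) ^ 2 * 2 = ((p ^ 2 * 2 : ℕ) : ℤ) := by push_cast; ring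
    have ic : IsCoprime ((p : ℤ) ^ 2) 2 := by
      have := Nat.isCoprime_iff_coprime.2 hodd
      exact_mod_cast this
    have parx := hpar x hx0
    have parz := hpar z hz0
    have d1 := Nat.div_add_mod x (p ^ 2)
    have d2 := Nat.div_add_mod z (p ^ 2)
    have m1 := Nat.mod_lt x hpp
    have m2 := Nat.mod_lt z hpp
    rw [← hxz] at d2
    rcases sq_dvd_sub_or_add hp h2 hpn (h x hx0).1 (h z hz0).1 (h x hx0).2 (h z hz0).2 with hd | hd
    · have e : (p : ℤ) ^ 2 ∣ (x : ℤ) - z := hd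
      have : ((p ^ 2 : ℕ) : ℤ) ∣ (x : ℤ) - z := by exact_mod_cast e
      have hlt : |(x : ℤ) - z| < ((p ^ 2 : ℕ) : ℤ) := by
        rw [abs_lt]
        constructor <;> linarith [(Nat.cast_nonneg (α := ℤ) (x % p ^ 2)),
          (Nat.cast_nonneg (α := ℤ) (z % p ^ 2)), (Nat.cast_lt (α := ℤ)).2 m1,
          (Nat.cast_lt (α := ℤ)).2 m2, congrArg (Nat.cast (R := ℤ)) d1,
          congrArg (Nat.cast (R := ℤ)) d2,
          (Nat.cast_add (R := ℤ) (p ^ 2 * (x / p ^ 2)) (x % p ^ 2)),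
          (Nat.cast_add (R := ℤ) (p ^ 2 * (x / p ^ 2)) (z % p ^ 2))]
      have := Int.eq_zero_of_abs_lt_dvd this hlt
      omega
    · have he : (2 : ℤ) ∣ (x : ℤ) + z := by omega
      have hm := ic.mul_dvd hd he
      rw [hpz] at hm
      have hm' : p ^ 2 * 2 ∣ x + z := by exact_mod_cast hm
      have hr : p ^ 2 * 2 ∣ x % p ^ 2 + z % p ^ 2 := by
        have e : x + z = p ^ 2 * 2 * (x / p ^ 2) + (x % p ^ 2 + z % p ^ 2) := by
          rw [show p ^ 2 * 2 * (x / p ^ 2) = p ^ 2 * (x / p ^ 2) + p ^ 2 * (x / p ^ 2) by ring]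
          omega
        rw [e] at hm'
        exact (Nat.dvd_add_right (dvd_mul_right _ _)).1 hm'
      have := Nat.eq_zero_of_dvd_of_lt hr (by linarith)
      obtain ⟨hx1, hz1⟩ := Nat.add_eq_zero_iff.1 this
      rw [← d1, ← d2, hx1, hz1]

theorem card_filter_mod_mem {W J : ℕ} {C : Finset ℕ} (hC : C ⊆ range W) :
    ((range (W * J)).filter (fun x => x % W ∈ C)).card = C.card * J := by
  have : (range (W * J)).filter (fun x => x % W ∈ C)
      = (C ×ˢ range J).image (fun v => v.1 + W * v.2) := by
    ext x
    simp only [mem_filter, mem_range, mem_image, mem_product, Prod.exists]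
    constructor
    · rintro ⟨h1, h2⟩
      have hW : 0 < W := Nat.pos_of_ne_zero (by rintro rfl; simp at h1)
      exact ⟨x % W, x / W, ⟨h2, Nat.div_lt_of_lt_mul h1⟩, Nat.mod_add_div x W⟩
    · rintro ⟨a, j, ⟨ha, hj⟩, rfl⟩
      have haW := mem_range.1 (hC ha)
      refine ⟨?_, by rwa [Nat.add_mul_mod_self_left, Nat.mod_eq_of_lt haW]⟩
      calc a + W * j < W * (j + 1) := by rw [mul_add, mul_one]; omega
        _ ≤ W * J := Nat.mul_le_mul_left _ hj
  rw [this, card_image_of_injOn, card_product, card_range]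
  rintro ⟨a, i⟩ ha ⟨b, j⟩ hb hab
  simp only [coe_product, coe_range, Set.mem_prod, mem_coe] at ha hb hab
  have haW := mem_range.1 (hC ha.1)
  have hbW := mem_range.1 (hC hb.1)
  have h1 : a = b := by
    have := congrArg (· % W) hab
    simpa [Nat.add_mul_mod_self_left, Nat.mod_eq_of_lt haW, Nat.mod_eq_of_lt hbW] using this
  subst h1
  have h2 : W * i = W * j := by omega
  rw [Nat.eq_of_mul_eq_mul_left (by omega) h2]

theorem card_filter_progressions_le {W J B : ℕ} {C : Finset ℕ} (P : ℕ → Prop) [DecidablePred P]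
    (h : ∀ a ∈ C, ((range J).filter (fun j => P (a + W * j))).card ≤ B) :
    (((range (W * J)).filter (fun x => x % W ∈ C)).filter P).card ≤ C.card * B := by
  calc _ ≤ (C.biUnion fun a => ((range J).filter (fun j => P (a + W * j))).image
        (fun j => a + W * j)).card := by
        refine card_le_card ?_
        intro x hx
        simp only [mem_filter, mem_range, mem_biUnion, mem_image] at hx ⊢
        exact ⟨x % W, hx.1.2, x / W,
          ⟨Nat.div_lt_of_lt_mul hx.1.1, by rw [Nat.mod_add_div]; exact hx.2⟩,
          Nat.mod_add_div x W⟩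
    _ ≤ C.card * B := card_biUnion_le_card_mul _ _ _ fun a ha => card_image_le.trans (h a ha)

theorem sieve_inequality {n W J L y : ℕ} {C Q F : Finset ℕ} (hC : C ⊆ range W) (hW : 18 ∣ W)
    (hpar : ∀ a ∈ C, a % 2 ≠ n % 2) (hnine : ∀ a ∈ C, a ^ 2 % 9 ≠ n % 9)
    (hcop : ∀ a ∈ C, ∀ p, p.Prime → p ∣ n → p ∣ W → ¬ p ∣ a)
    (hQ : ∀ p, p.Prime → p ∣ n → ¬ p ∣ W → p ∈ Q) (hQW : ∀ q ∈ Q, q.Coprime W)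
    (hF : ∀ l ∈ F, l.Prime ∧ ¬ l ∣ n ∧ l.Coprime W)
    (hFL : ∀ p, p.Prime → 5 ≤ p → p ≤ L → ¬ p ∣ n → p ∈ F)
    (hWJ : (W * J) ^ 2 ≤ n)
    (hy : ∀ x p, p.Prime → x ^ 2 < n → x.Coprime n → p ^ 2 ∣ n - x ^ 2 → x % 2 ≠ n % 2 → p ≤ y)
    (hbad : ∀ x, x ^ 2 ≤ n → x.Coprime n → ¬ Squarefree (n - x ^ 2)) :
    C.card * J ≤ ∑ q ∈ Q, C.card * (J / q + 1) + ∑ l ∈ F, C.card * (2 * (J / l ^ 2 + 1))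
      + ∑ p ∈ (Ioc L y).filter Nat.Prime, (W * J / p ^ 2 + 1) := by
  classical
  set X := (range (W * J)).filter (fun x => x % W ∈ C) with hX
  have h2W : 2 ∣ W := (by norm_num : (2 : ℕ) ∣ 18).trans hW
  have h9W : 9 ∣ W := (by norm_num : (9 : ℕ) ∣ 18).trans hW
  have h3W : 3 ∣ W := (by norm_num : (3 : ℕ) ∣ 18).trans hW
  have hXsq : ∀ x, x < W * J → x ^ 2 ≤ n := fun x hx =>
    (Nat.pow_le_pow_left hx.le 2).trans hWJ
  have hXpar : ∀ x ∈ X, x % 2 ≠ n % 2 := by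
    intro x hx
    have := hpar _ (mem_filter.1 hx).2
    rwa [Nat.mod_mod_of_dvd _ h2W] at this
  have ne2 : ∀ x p, x % 2 ≠ n % 2 → x ^ 2 ≤ n → p ^ 2 ∣ n - x ^ 2 → p ≠ 2 := by
    rintro x p hp hx hd rfl
    have h2 : 2 ∣ n - x ^ 2 := (dvd_pow_self 2 two_ne_zero).trans hd
    have h3 : x ^ 2 % 2 = x % 2 := by
      rw [Nat.pow_mod]; rcases Nat.mod_two_eq_zero_or_one x with h | h <;> rw [h]
    omega
  have cover : X ⊆ (Q.biUnion fun q => X.filter (fun x => q ∣ x)) ∪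
      (F.biUnion fun l => X.filter (fun x => x ^ 2 ≤ n ∧ l ^ 2 ∣ n - x ^ 2)) ∪
      (((Ioc L y).filter Nat.Prime).biUnion fun p =>
        X.filter (fun x => ¬ p ∣ n ∧ p ≠ 2 ∧ x ^ 2 ≤ n ∧ p ^ 2 ∣ n - x ^ 2)) := by
    intro x hx
    have hx' := mem_filter.1 hx
    have hxlt := mem_range.1 hx'.1
    have hxn := hXsq x hxlt
    have hp2 := hXpar x hx
    by_cases hq : ∃ q ∈ Q, q ∣ x
    · obtain ⟨q, hq, hqx⟩ := hq
      refine mem_union_left _ (mem_union_left _ (mem_biUnion.2 ⟨q, hq, mem_filter.2 ⟨hx, hqx⟩⟩))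
    push Not at hq
    have hxc : x.Coprime n := by
      apply Nat.Coprime.symm
      apply Nat.coprime_of_dvd
      intro p hp hpn hpx
      by_cases hpW : p ∣ W
      · exact hcop _ hx'.2 p hp hpn hpW ((Nat.dvd_mod_iff hpW).2 hpx)
      · exact hq p (hQ p hp hpn hpW) hpx
    have hsq := hbad x hxn hxc
    rw [Nat.squarefree_iff_prime_squarefree] at hsq
    push Not at hsq
    obtain ⟨p, hp, hpd⟩ := hsq
    rw [← pow_two] at hpd
    have hlt : x ^ 2 < n := by
      refine lt_of_le_of_ne hxn ?_
      rintro rfl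
      apply hp2
      rw [Nat.pow_mod]; rcases Nat.mod_two_eq_zero_or_one x with h | h <;> rw [h]
    have hpn : ¬ p ∣ n := by
      intro hpn
      have h1 : p ∣ n - x ^ 2 := (dvd_pow_self p two_ne_zero).trans hpd
      have h2 : p ∣ x ^ 2 := by
        have := Nat.dvd_sub hpn h1
        rwa [Nat.sub_sub_self hxn] at this
      exact (Nat.Prime.one_lt hp).ne' (Nat.eq_one_of_dvd_coprimes hxc (hp.dvd_of_dvd_pow h2) hpn)
    have hpne2 := ne2 x p hp2 hxn hpd
    have hpne3 : p ≠ 3 := by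
      rintro rfl
      apply hnine _ hx'.2
      have h1 : (x % W) ^ 2 % 9 = x ^ 2 % 9 := by
        rw [Nat.pow_mod, Nat.mod_mod_of_dvd _ h9W, ← Nat.pow_mod]
      rw [h1]
      exact (Nat.modEq_iff_dvd' hxn).2 hpd
    have hp5 : 5 ≤ p := by
      have := hp.two_le
      rcases Nat.lt_or_ge p 5 with h | h
      · interval_cases p <;> first | omega | exact absurd hp (by norm_num)
      · exact h
    by_cases hpL : p ≤ L
    · exact mem_union_left _ (mem_union_right _ (mem_biUnion.2
        ⟨p, hFL p hp hp5 hpL hpn, mem_filter.2 ⟨hx, hxn, hpd⟩⟩))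
    · refine mem_union_right _ (mem_biUnion.2 ⟨p, mem_filter.2 ⟨mem_Ioc.2 ⟨not_le.1 hpL, ?_⟩, hp⟩,
        mem_filter.2 ⟨hx, hpn, hpne2, hxn, hpd⟩⟩)
      exact hy x p hp hlt hxc hpd hp2
  rw [← card_filter_mod_mem (J := J) hC]
  refine (card_le_card cover).trans ((card_union_le _ _).trans (add_le_add
    ((card_union_le _ _).trans (add_le_add ?_ ?_)) ?_))
  · refine card_biUnion_le.trans (sum_le_sum fun q hq => ?_)
    refine card_filter_progressions_le _ fun a _ => ?_
    exact card_progression_dvd_le (filter_subset _ _) (hQW q hq) fun j hj => (mem_filter.1 hj).2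
  · refine card_biUnion_le.trans (sum_le_sum fun l hl => ?_)
    obtain ⟨h1, h2, h3⟩ := hF l hl
    refine card_filter_progressions_le _ fun a _ => ?_
    refine card_progression_sq_dvd_le (filter_subset _ _) h1 ?_ h2 h3
      fun j hj => (mem_filter.1 hj).2
    rintro rfl
    exact absurd (Nat.eq_one_of_dvd_coprimes h3 dvd_rfl h2W) (by norm_num)
  · refine card_biUnion_le.trans (sum_le_sum fun p hp => ?_)
    by_cases hpn : p ∣ n ∨ p = 2
    · rw [filter_false_of_mem (by tauto)]; simp
    · push Not at hpn
      refine card_large_prime_le (mem_filter.1 hp).2 hpn.2 hpn.1 (fun x hx => ?_) (fun x hx => ?_)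
        fun x hx => ⟨(mem_filter.1 hx).2.2.2.1, (mem_filter.1 hx).2.2.2.2⟩
      · exact (mem_range.1 (mem_filter.1 (mem_filter.1 hx).1).1).le
      · exact hXpar x (mem_filter.1 hx).1

theorem le_sqrt_div_of_cofactor {n x p k c : ℕ} (hc : 0 < c) (h : n - x ^ 2 = p ^ 2 * k)
    (hk : c ≤ k) : p ≤ Nat.sqrt (n / c) := by
  rw [Nat.le_sqrt', Nat.le_div_iff_mul_le hc]
  calc p ^ 2 * c ≤ p ^ 2 * k := Nat.mul_le_mul_left _ hk
    _ = n - x ^ 2 := h.symm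
    _ ≤ n := Nat.sub_le _ _

theorem odd_cofactor {n x p k : ℕ} (hx : x ^ 2 < n) (hpar : x % 2 ≠ n % 2)
    (h : n - x ^ 2 = p ^ 2 * k) : k % 2 = 1 := by
  have h3 : x ^ 2 % 2 = x % 2 := by
    rw [Nat.pow_mod]; rcases Nat.mod_two_eq_zero_or_one x with h | h <;> rw [h]
  rcases Nat.mod_two_eq_zero_or_one k with h0 | h0
  · have : (p ^ 2 * k) % 2 = 0 := by rw [Nat.mul_mod, h0]; simp
    omega
  · exact h0

theorem prime_le_sqrt {n x p : ℕ} (hx : x ^ 2 < n) (hpar : x % 2 ≠ n % 2)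
    (hd : p ^ 2 ∣ n - x ^ 2) : p ≤ Nat.sqrt (n / 1) := by
  obtain ⟨k, hk⟩ := hd
  have := odd_cofactor hx hpar hk
  exact le_sqrt_div_of_cofactor one_pos hk (by omega)

theorem prime_le_sqrt_div_three {n x p q : ℕ} (hq : q.Prime) (hq4 : q % 4 = 3) (hqn : q ∣ n)
    (hx : x ^ 2 < n) (hxn : x.Coprime n) (hpar : x % 2 ≠ n % 2)
    (hd : p ^ 2 ∣ n - x ^ 2) : p ≤ Nat.sqrt (n / 3) := by
  obtain ⟨k, hk⟩ := hd
  have hk2 := odd_cofactor hx hpar hk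
  refine le_sqrt_div_of_cofactor (by norm_num) hk ?_
  by_contra hlt
  have hk1 : k = 1 := by omega
  subst hk1
  have hn : n = x ^ 2 + p ^ 2 := by omega
  have := Fact.mk hq
  have hz : (x : ZMod q) ^ 2 + (p : ZMod q) ^ 2 = 0 := by
    have : ((n : ℕ) : ZMod q) = 0 := (ZMod.natCast_eq_zero_iff n q).2 hqn
    rw [hn] at this; exact_mod_cast this
  have hx0 : (x : ZMod q) ≠ 0 := by
    intro h0
    rw [ZMod.natCast_eq_zero_iff] at h0
    exact hq.one_lt.ne' (Nat.eq_one_of_dvd_coprimes hxn h0 hqn)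
  exact ZMod.mod_four_ne_three_of_sq_eq_neg_one (y := (p / x : ZMod q))
    (by field_simp; linear_combination hz) hq4

theorem prime_le_sqrt_div_five {n x p : ℕ} (h3 : 3 ∣ n)
    (hx : x ^ 2 < n) (hxn : x.Coprime n) (hpar : x % 2 ≠ n % 2)
    (hd : p ^ 2 ∣ n - x ^ 2) : p ≤ Nat.sqrt (n / 5) := by
  obtain ⟨k, hk⟩ := hd
  have hk2 := odd_cofactor hx hpar hk
  refine le_sqrt_div_of_cofactor (by norm_num) hk ?_
  have hn : n = x ^ 2 + p ^ 2 * k := by omega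
  have hx3 : ¬ 3 ∣ x := fun h => by
    have := Nat.eq_one_of_dvd_coprimes hxn h h3
    omega
  have hx1 : x ^ 2 % 3 = 1 := by
    have : x % 3 = 1 ∨ x % 3 = 2 := by omega
    rw [Nat.pow_mod]; rcases this with h | h <;> rw [h]
  have hk3 : p ^ 2 * k % 3 = 2 := by omega
  have hp3 : p ^ 2 % 3 = 1 := by
    have : p % 3 = 0 ∨ p % 3 = 1 ∨ p % 3 = 2 := by omega
    rw [Nat.mul_mod, Nat.pow_mod] at hk3
    rw [Nat.pow_mod]
    rcases this with h | h | h <;> rw [h] at hk3 ⊢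
    simp at hk3
  have hk4 : k % 3 = 2 := by
    rw [Nat.mul_mod, hp3, one_mul, Nat.mod_mod] at hk3; exact hk3
  omega

theorem exists_residues_mod_eighteen (n : ℕ) : ∃ C : Finset ℕ, C ⊆ range 18 ∧
    C.card = (if 3 ∣ n then 6 else 7) ∧
    ∀ a ∈ C, a % 2 ≠ n % 2 ∧ a ^ 2 % 9 ≠ n % 9 ∧ (3 ∣ n → ¬ 3 ∣ a) := by
  have key : ∀ r < 18, (if 3 ∣ r then 6 else 7) ≤ ((range 18).filter
      (fun a => a % 2 ≠ r % 2 ∧ a ^ 2 % 9 ≠ r % 9 ∧ (3 ∣ r → ¬ 3 ∣ a))).card := by decide +kernel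
  obtain ⟨C, hC, hc⟩ := exists_subset_card_eq (key (n % 18) (Nat.mod_lt _ (by norm_num)))
  have h3 : 3 ∣ n % 18 ↔ 3 ∣ n := Nat.dvd_mod_iff (by norm_num)
  have h2 : n % 18 % 2 = n % 2 := Nat.mod_mod_of_dvd _ (by norm_num)
  have h9 : n % 18 % 9 = n % 9 := Nat.mod_mod_of_dvd _ (by norm_num)
  simp only [h3, h2, h9] at hC hc
  exact ⟨C, hC.trans (filter_subset _ _), hc, fun a ha => (mem_filter.1 (hC ha)).2⟩

theorem exists_residues_mul_prime {W q : ℕ} {C : Finset ℕ} (hC : C ⊆ range W)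
    (hqW : q.Coprime W) : ∃ C' : Finset ℕ, C' ⊆ range (W * q) ∧ C'.card = C.card * (q - 1) ∧
      ∀ a ∈ C', a % W ∈ C ∧ ¬ q ∣ a := by
  set X := (range (W * q)).filter (fun x => x % W ∈ C)
  have h1 : X.card = C.card * q := card_filter_mod_mem hC
  have h2 : (X.filter (fun x => q ∣ x)).card ≤ C.card * 1 := by
    refine card_filter_progressions_le _ fun a _ => ?_
    rw [card_le_one]
    intro i hi j hj
    simp only [mem_filter, mem_range] at hi hj
    have h1 : a + W * i ≡ a + W * j [MOD q] :=
      ((Nat.modEq_zero_iff_dvd.2 hi.2)).trans (Nat.modEq_zero_iff_dvd.2 hj.2).symm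
    exact Nat.ModEq.eq_of_lt_of_lt
      (Nat.ModEq.cancel_left_of_coprime hqW (Nat.ModEq.add_left_cancel' a h1)) hi.1 hj.1
  have h3 := card_filter_add_card_filter_not (s := X) (fun x => q ∣ x)
  have h4 : C.card * (q - 1) ≤ (X.filter (fun x => ¬ q ∣ x)).card := by
    rw [Nat.mul_sub]; omega
  obtain ⟨C', hC', hc⟩ := exists_subset_card_eq h4
  refine ⟨C', hC'.trans ((filter_subset _ _).trans (filter_subset _ _)), hc, fun a ha => ?_⟩
  have := mem_filter.1 (hC' ha)
  exact ⟨(mem_filter.1 this.1).2, this.2⟩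

theorem coprime_eighteen_of_prime {q : ℕ} (hq : q.Prime) (h5 : 5 ≤ q) : q.Coprime 18 := by
  rw [Nat.Prime.coprime_iff_not_dvd hq]
  intro h
  have h1 : q ∣ 2 * 3 ^ 2 := by norm_num; exact h
  rcases (Nat.Prime.dvd_mul hq).1 h1 with h | h
  · have := Nat.le_of_dvd (by norm_num) h; omega
  · have := Nat.le_of_dvd (by norm_num) (hq.dvd_of_dvd_pow h); omega

theorem coprime_prod_of_notMem {q : ℕ} {S : Finset ℕ} (hq : q.Prime) (hS : ∀ p ∈ S, p.Prime)
    (h : q ∉ S) : q.Coprime (∏ p ∈ S, p) :=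
  Nat.Coprime.prod_right fun p hp => (Nat.coprime_primes hq (hS p hp)).2 (by rintro rfl; exact h hp)

theorem exists_residues {S C₀ : Finset ℕ} (hC₀ : C₀ ⊆ range 18)
    (hS : ∀ q ∈ S, q.Prime ∧ 5 ≤ q) : ∃ C : Finset ℕ, C ⊆ range (18 * ∏ q ∈ S, q) ∧
      C.card = C₀.card * ∏ q ∈ S, (q - 1) ∧ ∀ a ∈ C, a % 18 ∈ C₀ ∧ ∀ q ∈ S, ¬ q ∣ a := by
  induction S using Finset.induction_on with
  | empty => exact ⟨C₀, by simpa using hC₀, by simp, fun a ha => by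
      simpa [Nat.mod_eq_of_lt (mem_range.1 (hC₀ ha))] using ha⟩
  | insert q S hqS ih =>
    obtain ⟨C, h1, h2, h3⟩ := ih fun p hp => hS p (mem_insert_of_mem hp)
    obtain ⟨hq, h5⟩ := hS q (mem_insert_self _ _)
    have hco : q.Coprime (18 * ∏ q ∈ S, q) := Nat.Coprime.mul_right
      (coprime_eighteen_of_prime hq h5)
      (coprime_prod_of_notMem hq (fun p hp => (hS p (mem_insert_of_mem hp)).1) hqS)
    obtain ⟨C', h4, h5, h6⟩ := exists_residues_mul_prime h1 hco
    rw [prod_insert hqS, prod_insert hqS]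
    refine ⟨C', by rwa [mul_left_comm, mul_comm], by rw [h5, h2]; ring, fun a ha => ?_⟩
    obtain ⟨h7, h8⟩ := h6 a ha
    obtain ⟨h9, h10⟩ := h3 _ h7
    rw [Nat.mod_mod_of_dvd _ (dvd_mul_right _ _)] at h9
    refine ⟨h9, fun p hp => ?_⟩
    rcases mem_insert.1 hp with rfl | hp
    · exact h8
    · exact fun h => h10 p hp ((Nat.dvd_mod_iff ((dvd_prod_of_mem _ hp).mul_left 18)).2 h)

/-- A finite set of numbers with bounded product has at most as many elements, and at most as large
a sum of reciprocals, as an initial segment `T` of the admissible numbers with larger product. -/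
theorem card_le_and_sum_inv_le {A T : Finset ℕ} {w : ℕ} (hw : 0 < w) (hT : ∀ q ∈ T, 0 < q ∧ q ≤ w)
    (hA : ∀ q ∈ A, q < w → q ∈ T) (hA0 : ∀ q ∈ A, 0 < q) (hprod : ∏ q ∈ A, q < w * ∏ q ∈ T, q) :
    A.card ≤ T.card ∧ ∑ q ∈ A, (1 / q : ℚ) ≤ ∑ q ∈ T, (1 / q : ℚ) := by
  have hw' : (0 : ℚ) < w := by exact_mod_cast hw
  have key : (A \ T).card ≤ (T \ A).card := by
    by_contra! hlt
    apply hprod.not_ge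
    rw [← prod_sdiff (inter_subset_left (s₁ := T) (s₂ := A)),
      ← prod_sdiff (inter_subset_left (s₁ := A) (s₂ := T)), inter_comm, sdiff_inter_self_left,
      sdiff_inter_self_right, ← mul_assoc]
    refine Nat.mul_le_mul_right _ ?_
    calc w * ∏ q ∈ T \ A, q ≤ w * w ^ (T \ A).card :=
          Nat.mul_le_mul_left _ (prod_le_pow_card _ _ _ fun q hq => (hT q (mem_sdiff.1 hq).1).2)
      _ = w ^ ((T \ A).card + 1) := by ring
      _ ≤ w ^ (A \ T).card := Nat.pow_le_pow_right hw hlt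
      _ ≤ ∏ q ∈ A \ T, q := by
        refine pow_card_le_prod _ _ _ fun q hq => ?_
        by_contra! h
        exact (mem_sdiff.1 hq).2 (hA q (mem_sdiff.1 hq).1 h)
  constructor
  · have h1 := card_sdiff_add_card_inter A T
    have h2 := card_sdiff_add_card_inter T A
    rw [inter_comm] at h2
    omega
  · rw [← sum_sdiff (inter_subset_left (s₁ := T) (s₂ := A)),
      ← sum_sdiff (inter_subset_left (s₁ := A) (s₂ := T)), inter_comm T A, sdiff_inter_self_left,
      inter_comm A T, sdiff_inter_self_left]
    refine add_le_add_left ?_ _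
    calc ∑ q ∈ A \ T, (1 / q : ℚ) ≤ (A \ T).card • (1 / w : ℚ) := by
          refine sum_le_card_nsmul _ _ _ fun q hq => ?_
          have hq0 : (0 : ℚ) < q := by exact_mod_cast hA0 q (mem_sdiff.1 hq).1
          have : (w : ℚ) ≤ q := by
            by_contra! h
            exact (mem_sdiff.1 hq).2 (hA q (mem_sdiff.1 hq).1 (by exact_mod_cast h))
          exact one_div_le_one_div_of_le hw' this
      _ ≤ (T \ A).card • (1 / w : ℚ) := by
          rw [nsmul_eq_mul, nsmul_eq_mul]
          gcongr
      _ ≤ ∑ q ∈ T \ A, (1 / q : ℚ) := by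
          refine card_nsmul_le_sum _ _ _ fun q hq => ?_
          obtain ⟨h1, h2⟩ := hT q (mem_sdiff.1 hq).1
          have h1' : (0 : ℚ) < q := by exact_mod_cast h1
          exact one_div_le_one_div_of_le h1' (by exact_mod_cast h2)

theorem sieve_arithmetic {Φ W J N π q f R₁ R₂ R σ : ℚ} (hΦ : 0 ≤ Φ) (hW : 0 < W) (hJ : 0 ≤ J)
    (hπ : 0 ≤ π) (hN0 : 0 ≤ N) (hqf : 0 ≤ 1 + q + 2 * f) (hσ : 0 ≤ σ) (hR0 : 0 ≤ R) (hR : R₁ + R₂ ≤ R)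
    (hN : N ≤ W * J + W)
    (h : Φ * J ≤ Φ * (J * R₁ + q) + Φ * (J * R₂ + 2 * f) + (W * J * σ + π)) :
    N * (Φ / W * (1 - R) - σ) ≤ π + Φ * (1 + q + 2 * f) := by
  set M := Φ / W * (1 - R) - σ with hM
  have hWM : W * M = Φ * (1 - R) - W * σ := by rw [hM]; field_simp
  have hJR : Φ * J * (R₁ + R₂) ≤ Φ * J * R := mul_le_mul_of_nonneg_left hR (mul_nonneg hΦ hJ)
  have f1 : J * (W * M) ≤ Φ * (q + 2 * f) + π := by rw [hWM]; linarith
  have f2 : W * M ≤ Φ := by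
    rw [hWM]; linarith [mul_nonneg hΦ hR0, mul_nonneg hW.le hσ]
  rcases le_total 0 M with h0 | h0
  · have f3 : N * M ≤ (W * J + W) * M := mul_le_mul_of_nonneg_right hN h0
    linarith
  · linarith [mul_nonneg hΦ hqf, mul_nonneg hN0 (neg_nonneg.2 h0)]

theorem sieve_inequality_cast {c J W L y : ℕ} {Q F : Finset ℕ} {σ : ℚ}
    (hσ : ∑ p ∈ (Ioc L y).filter Nat.Prime, (1 / p ^ 2 : ℚ) ≤ σ)
    (main : c * J ≤ ∑ q ∈ Q, c * (J / q + 1) + ∑ l ∈ F, c * (2 * (J / l ^ 2 + 1))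
      + ∑ p ∈ (Ioc L y).filter Nat.Prime, (W * J / p ^ 2 + 1)) :
    (c : ℚ) * J ≤ c * (J * ∑ q ∈ Q, (1 / q : ℚ) + Q.card)
      + c * (J * ∑ l ∈ F, (2 / l ^ 2 : ℚ) + 2 * F.card) + (W * J * σ + y.primeCounting) := by
  have hcardπ : ((Ioc L y).filter Nat.Prime).card ≤ y.primeCounting := by
    rw [Nat.primeCounting, Nat.primeCounting', Nat.count_eq_card_filter_range]
    refine card_le_card (filter_subset_filter _ fun p hp => ?_)
    simp only [mem_Ioc] at hp
    exact mem_range.2 (by omega)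
  have e1 : ∑ q ∈ Q, (c : ℚ) * ((J / q : ℕ) + 1)
      ≤ c * (J * ∑ q ∈ Q, (1 / q : ℚ) + Q.card) := by
    rw [← mul_sum, sum_add_distrib, mul_sum, sum_const, nsmul_eq_mul, mul_one]
    gcongr with q hq
    rw [mul_one_div]; exact Nat.cast_div_le
  have e2 : ∑ l ∈ F, (c : ℚ) * (2 * ((J / l ^ 2 : ℕ) + 1))
      ≤ c * (J * ∑ l ∈ F, (2 / l ^ 2 : ℚ) + 2 * F.card) := by
    rw [← mul_sum]
    refine mul_le_mul_of_nonneg_left ?_ (Nat.cast_nonneg _)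
    have e : (2 * F.card : ℚ) = ∑ l ∈ F, 2 := by rw [sum_const, nsmul_eq_mul, mul_comm]
    rw [e, mul_sum, ← sum_add_distrib]
    refine sum_le_sum fun l _ => ?_
    have := Nat.cast_div_le (α := ℚ) (m := J) (n := l ^ 2)
    push_cast at this
    calc 2 * (((J / l ^ 2 : ℕ) : ℚ) + 1) ≤ 2 * (J / l ^ 2 + 1) := by gcongr
      _ = _ := by ring
  have e3 : ∑ p ∈ (Ioc L y).filter Nat.Prime, (((W * J / p ^ 2 : ℕ) : ℚ) + 1)
      ≤ (W * J : ℚ) * σ + y.primeCounting := by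
    rw [sum_add_distrib, sum_const, nsmul_eq_mul, mul_one]
    refine add_le_add ?_ (by exact_mod_cast hcardπ)
    refine le_trans ?_ (mul_le_mul_of_nonneg_left hσ (by positivity))
    rw [mul_sum]
    gcongr with p hp
    rw [mul_one_div]
    exact_mod_cast Nat.cast_div_le (α := ℚ) (m := W * J) (n := p ^ 2)
  have mainQ : (c : ℚ) * J ≤ ∑ q ∈ Q, (c : ℚ) * ((J / q : ℕ) + 1)
      + ∑ l ∈ F, (c : ℚ) * (2 * ((J / l ^ 2 : ℕ) + 1))
      + ∑ p ∈ (Ioc L y).filter Nat.Prime, (((W * J / p ^ 2 : ℕ) : ℚ) + 1) := by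
    exact_mod_cast main
  exact mainQ.trans (add_le_add (add_le_add e1 e2) e3)

theorem exists_primitive_of_sieve {n y L : ℕ} {S Q F : Finset ℕ} {σ R : ℚ}
    (hS : ∀ q ∈ S, q.Prime ∧ 5 ≤ q ∧ q ∣ n)
    (hQ : ∀ q ∈ Q, q.Prime ∧ 5 ≤ q ∧ q ∉ S)
    (hQc : ∀ p, p.Prime → 5 ≤ p → p ∣ n → p ∉ S → p ∈ Q)
    (hF : ∀ l ∈ F, l.Prime ∧ 5 ≤ l ∧ ¬ l ∣ n)
    (hFc : ∀ p, p.Prime → 5 ≤ p → p ≤ L → ¬ p ∣ n → p ∈ F)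
    (hy : ∀ x p, p.Prime → x ^ 2 < n → x.Coprime n → p ^ 2 ∣ n - x ^ 2 → x % 2 ≠ n % 2 → p ≤ y)
    (hσ : ∑ p ∈ (Ioc L y).filter Nat.Prime, (1 / p ^ 2 : ℚ) ≤ σ)
    (hR : ∑ q ∈ Q, (1 / q : ℚ) + ∑ l ∈ F, (2 / l ^ 2 : ℚ) ≤ R)
    (hmain : (y.primeCounting : ℚ) + ((if 3 ∣ n then 6 else 7 : ℕ) * ∏ q ∈ S, (q - 1) : ℕ)
      * (1 + Q.card + 2 * F.card) < Nat.sqrt n * ((((if 3 ∣ n then 6 else 7 : ℕ)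
        * ∏ q ∈ S, (q - 1) : ℕ) : ℚ) / (18 * ∏ q ∈ S, q : ℕ) * (1 - R) - σ)) :
    ∃ x : ℕ, x ^ 2 ≤ n ∧ x.Coprime n ∧ Squarefree (n - x ^ 2) := by
  by_contra! hbad
  obtain ⟨C₀, h1, h2, h3⟩ := exists_residues_mod_eighteen n
  obtain ⟨C, h4, h5, h6⟩ := exists_residues h1 fun q hq => ⟨(hS q hq).1, (hS q hq).2.1⟩
  rw [h2] at h5
  set W := 18 * ∏ q ∈ S, q with hW
  rw [← h5] at hmain
  have hW18 : 18 ∣ W := dvd_mul_right _ _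
  have hW0 : 0 < W := Nat.mul_pos (by norm_num) (prod_pos fun q hq => (hS q hq).1.pos)
  have hcoW : ∀ q, q.Prime → 5 ≤ q → q ∉ S → q.Coprime W := fun q hq h5 hqS =>
    Nat.Coprime.mul_right (coprime_eighteen_of_prime hq h5)
      (coprime_prod_of_notMem hq (fun p hp => (hS p hp).1) hqS)
  have hpW : ∀ p, p.Prime → p ∣ W → p = 2 ∨ p = 3 ∨ p ∈ S := by
    intro p hp hpW
    by_contra! h
    have h5 : 5 ≤ p := by
      have := hp.two_le
      by_contra! hlt
      have : p = 4 := by omega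
      subst this; exact absurd hp (by norm_num)
    exact hp.one_lt.ne' (Nat.eq_one_of_dvd_coprimes (hcoW p hp h5 h.2.2) dvd_rfl hpW)
  set J := Nat.sqrt n / W with hJ
  have hWJ : W * J ≤ Nat.sqrt n := Nat.mul_div_le _ _
  have main := sieve_inequality (n := n) (J := J) (L := L) (y := y) (Q := Q) (F := F) h4 hW18
    (fun a ha => by
      have := (h3 _ (h6 a ha).1).1
      rwa [Nat.mod_mod_of_dvd _ (by norm_num)] at this)
    (fun a ha => by
      have := (h3 _ (h6 a ha).1).2.1
      rwa [Nat.pow_mod, Nat.mod_mod_of_dvd _ (by norm_num), ← Nat.pow_mod] at this)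
    (fun a ha p hp hpn hpd hpa => by
      obtain ⟨h7, -, h8⟩ := h3 _ (h6 a ha).1
      rcases hpW p hp hpd with rfl | rfl | hpS
      · rw [Nat.mod_mod_of_dvd _ (by norm_num)] at h7; omega
      · exact h8 hpn ((Nat.dvd_mod_iff (by norm_num)).2 hpa)
      · exact (h6 a ha).2 p hpS hpa)
    (fun p hp hpn hpd => by
      have h5 : 5 ≤ p := by
        have := hp.two_le
        by_contra! hlt
        have : p = 2 ∨ p = 3 ∨ p = 4 := by omega
        rcases this with rfl | rfl | rfl
        · exact hpd ((by norm_num : 2 ∣ 18).trans hW18)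
        · exact hpd ((by norm_num : 3 ∣ 18).trans hW18)
        · exact absurd hp (by norm_num)
      exact hQc p hp h5 hpn fun h => hpd ((dvd_prod_of_mem _ h).mul_left _))
    (fun q hq => hcoW q (hQ q hq).1 (hQ q hq).2.1 (hQ q hq).2.2)
    (fun l hl => ⟨(hF l hl).1, (hF l hl).2.2, hcoW l (hF l hl).1 (hF l hl).2.1
      fun h => (hF l hl).2.2 (hS l h).2.2⟩)
    hFc (by rwa [← Nat.le_sqrt']) hy hbad
  have hσ0 : 0 ≤ σ := le_trans (sum_nonneg fun p _ => by positivity) hσ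
  have hR0 : 0 ≤ R := le_trans (add_nonneg (sum_nonneg fun p _ => by positivity)
    (sum_nonneg fun p _ => by positivity)) hR
  have hN : (Nat.sqrt n : ℚ) ≤ W * J + W := by
    have h1 := Nat.div_add_mod (Nat.sqrt n) W
    have h2 := Nat.mod_lt (Nat.sqrt n) hW0
    have : Nat.sqrt n ≤ W * J + W := by rw [hJ]; omega
    exact_mod_cast this
  exact hmain.not_ge (sieve_arithmetic (Nat.cast_nonneg _) (by exact_mod_cast hW0)
    (Nat.cast_nonneg _) (Nat.cast_nonneg _) (Nat.cast_nonneg _) (by positivity) hσ0 hR0 hR hN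
    (sieve_inequality_cast hσ main))

theorem mul_card_primes_Ioc_le {m k : ℕ} (h : 2 ^ k ≤ m) :
    k * (2 * m).primeCounting ≤ k * m.primeCounting + 2 * m := by
  have h1 := primorial_add m m
  have h2 := primorial_add_dvd (le_refl m)
  set A := (Ico (m + 1) (m + m + 1)).filter Nat.Prime with hA
  rw [h1] at h2
  have h3 : ∏ p ∈ A, p ∣ (m + m).choose m := Nat.dvd_of_mul_dvd_mul_left (primorial_pos m) h2
  have h4 : ∏ p ∈ A, p ≤ 4 ^ m := by
    refine (Nat.le_of_dvd (Nat.choose_pos (by omega)) h3).trans ?_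
    have := Nat.centralBinom_le_four_pow m
    rwa [Nat.centralBinom, two_mul] at this
  have h5 : (2 ^ k) ^ A.card ≤ ∏ p ∈ A, p := by
    refine pow_card_le_prod _ _ _ fun p hp => ?_
    have := (mem_Ico.1 (mem_filter.1 hp).1).1
    omega
  have h6 : 2 ^ (k * A.card) ≤ 2 ^ (2 * m) := by
    rw [pow_mul, pow_mul 2 2 m]; exact h5.trans h4
  have h7 : k * A.card ≤ 2 * m := (Nat.pow_le_pow_iff_right (by norm_num)).1 h6
  have h8 : (2 * m).primeCounting ≤ m.primeCounting + A.card := by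
    rw [Nat.primeCounting, Nat.primeCounting', Nat.count_eq_card_filter_range, Nat.primeCounting,
      Nat.primeCounting', Nat.count_eq_card_filter_range]
    refine (card_le_card ?_).trans (card_union_le _ _)
    intro p hp
    simp only [hA, mem_union, mem_filter, mem_range, mem_Ico] at hp ⊢
    by_cases h : p < m + 1
    · exact Or.inl ⟨h, hp.2⟩
    · exact Or.inr ⟨⟨not_lt.1 h, by omega⟩, hp.2⟩
  calc k * (2 * m).primeCounting ≤ k * (m.primeCounting + A.card) := Nat.mul_le_mul_left _ h8
    _ ≤ _ := by rw [mul_add]; omega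

/-- The product of the primes below `446`. -/
def sieveModulus : ℕ :=
  106799349783510324633088196370154963001649294985563231205816767298822135097700082617263814630462281610668318462376243299771362029792038518622755267843677086440779983634954128409675690

/-- `1` if `m` is coprime to `P`, and `0` otherwise. -/
def coprimeIndicator (P m : ℕ) : ℕ := 1 - (Nat.gcd m P - 1)

def wheelCount (P i t : ℕ) : ℕ :=
  t + coprimeIndicator P (12 * i + 1) + coprimeIndicator P (12 * i + 5)
    + coprimeIndicator P (12 * i + 7) + coprimeIndicator P (12 * i + 11)

def scanBound (i : ℕ) : ℕ :=
  if i < 167 then 10 ^ 9 else if i < 250 then 153 * (12 * i) else if i < 317 then 145 * (12 * i)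
    else if i < 683 then 140 * (12 * i) else 130 * (12 * i)

/-- Running upper bound for the number of primes, or `0` if it exceeds `scanBound` somewhere. -/
def primeScan (P : ℕ) : ℕ → ℕ → ℕ → ℕ
  | 0, i, t => if 1000 * wheelCount P i t ≤ scanBound i then wheelCount P i t else 0
  | k + 1, i, t => match primeScan P k i t with
    | 0 => 0
    | s + 1 => primeScan P k (i + 2 ^ k) (s + 1)

theorem prime_indicator_le {P p : ℕ} (hP : ∀ q, q.Prime → q ∣ P → q < p) :
    (if p.Prime then 1 else 0) ≤ coprimeIndicator P p := by
  split_ifs with hp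
  · have : Nat.gcd p P = 1 := by
      rw [← Nat.coprime_iff_gcd_eq_one, Nat.Prime.coprime_iff_not_dvd hp]
      exact fun h => (hP p hp h).false
    simp [coprimeIndicator, this]
  · exact Nat.zero_le _

theorem count_prime_le_wheelCount {P i t : ℕ} (hi : 1 < i)
    (hP : ∀ q, q.Prime → q ∣ P → q < 12 * i) (ht : Nat.count Nat.Prime (12 * i) ≤ t) :
    Nat.count Nat.Prime (12 * (i + 1)) ≤ wheelCount P i t := by
  have h : ∀ d, d < 12 → ¬ Nat.Coprime d 12 → ¬ (12 * i + d).Prime := by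
    intro d hd hdc hp
    apply hdc
    have : Nat.Coprime (12 * i + d) 12 := by
      rw [Nat.Prime.coprime_iff_not_dvd hp]
      intro h
      have := Nat.le_of_dvd (by norm_num) h
      omega
    simpa using this
  have h0 := h 0 (by norm_num) (by decide)
  have h2 := h 2 (by norm_num) (by decide)
  have h3 := h 3 (by norm_num) (by decide)
  have h4 := h 4 (by norm_num) (by decide)
  have h6 := h 6 (by norm_num) (by decide)
  have h8 := h 8 (by norm_num) (by decide)
  have h9 := h 9 (by norm_num) (by decide)
  have h10 := h 10 (by norm_num) (by decide)
  have g : ∀ d, (if (12 * i + d).Prime then 1 else 0) ≤ coprimeIndicator P (12 * i + d) :=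
    fun d => prime_indicator_le fun q hq hqP => (hP q hq hqP).trans_le (Nat.le_add_right _ _)
  have e : 12 * (i + 1) = 12 * i + 0 + 1 + 1 + 1 + 1 + 1 + 1 + 1 + 1 + 1 + 1 + 1 + 1 := by ring
  rw [e]
  simp only [Nat.count_succ, add_assoc, Nat.reduceAdd, add_zero] at h0 h2 ⊢
  simp only [h0, h2, h3, h4, h6, h8, h9, h10, if_false]
  have g1 := g 1
  have g5 := g 5
  have g7 := g 7
  have g11 := g 11
  simp only [wheelCount]
  omega

theorem primeScan_spec {P : ℕ} : ∀ k i t r : ℕ, 1 < i → (∀ q, q.Prime → q ∣ P → q < 12 * i) →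
    Nat.count Nat.Prime (12 * i) ≤ t → primeScan P k i t = r → 0 < r →
    Nat.count Nat.Prime (12 * (i + 2 ^ k)) ≤ r ∧
    ∀ j, i ≤ j → j < i + 2 ^ k → 1000 * Nat.count Nat.Prime (12 * (j + 1)) ≤ scanBound j := by
  intro k
  induction k with
  | zero =>
    intro i t r hi hP ht hr hr0
    rw [primeScan] at hr
    have hc := count_prime_le_wheelCount hi hP ht
    split_ifs at hr with h
    · subst hr
      refine ⟨by simpa using hc, fun j h1 h2 => ?_⟩
      obtain rfl : j = i := by simp at h2; omega
      exact (Nat.mul_le_mul_left _ hc).trans h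
    · omega
  | succ k ih =>
    intro i t r hi hP ht hr hr0
    rw [primeScan] at hr
    rcases hs : primeScan P k i t with _ | s
    · rw [hs] at hr; simp at hr; omega
    · rw [hs] at hr
      simp only at hr
      obtain ⟨h1, h2⟩ := ih i t _ hi hP ht hs (Nat.succ_pos _)
      have hpow := Nat.pos_of_ne_zero (pow_ne_zero k (two_ne_zero (α := ℕ)))
      obtain ⟨h3, h4⟩ := ih (i + 2 ^ k) (s + 1) r (by omega)
        (fun q hq hqP => (hP q hq hqP).trans_le (by omega)) h1 hr hr0
      rw [pow_succ, mul_two, ← add_assoc]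
      refine ⟨h3, fun j hj1 hj2 => ?_⟩
      by_cases hj : j < i + 2 ^ k
      · exact h2 j hj1 hj
      · exact h4 j (not_lt.1 hj) hj2

theorem lt_of_prime_dvd_sieveModulus {q : ℕ} (hq : q.Prime) (h : q ∣ sieveModulus) : q < 446 := by
  have h1 : sieveModulus ∣ Nat.factorial 445 := Nat.dvd_of_mod_eq_zero (by decide +kernel)
  have := hq.dvd_factorial.1 (h.trans h1)
  omega

theorem count_prime_456 : Nat.count Nat.Prime 456 = 87 := by decide +kernel

theorem primeScan_pos : 0 < primeScan sieveModulus 14 38 87 := by decide +kernel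

theorem primeCounting_le_scanBound {y : ℕ} (h1 : 456 ≤ y) (h2 : y < 197064) :
    1000 * y.primeCounting ≤ scanBound (y / 12) := by
  obtain ⟨-, h⟩ := primeScan_spec 14 38 87 _ (by norm_num)
    (fun q hq hqP => (lt_of_prime_dvd_sieveModulus hq hqP).trans (by norm_num))
    count_prime_456.le rfl primeScan_pos
  refine le_trans ?_ (h (y / 12) (by omega) (by omega))
  exact Nat.mul_le_mul_left _ (Nat.count_monotone _ (by omega))

theorem primeCounting_le_of_half {y k : ℕ} (h : 2 ^ (k + 1) ≤ y) :
    k * y.primeCounting ≤ k * ((y + 1) / 2).primeCounting + 2 * ((y + 1) / 2) := by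
  have h1 : 2 ^ k ≤ (y + 1) / 2 := by rw [pow_succ] at h; omega
  refine le_trans ?_ (mul_card_primes_Ioc_le h1)
  exact Nat.mul_le_mul_left _ (Nat.monotone_primeCounting (by omega))

theorem primeCounting_le_thirteen {y : ℕ} (h : 8196 ≤ y) : 100 * y.primeCounting ≤ 13 * y := by
  induction y using Nat.strong_induction_on with
  | _ y ih =>
    rcases Nat.lt_or_ge y 197064 with hlt | hge
    · have := primeCounting_le_scanBound (y := y) (by omega) hlt
      rw [scanBound, if_neg (by omega), if_neg (by omega), if_neg (by omega),
        if_neg (by omega)] at this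
      omega
    · have h1 := ih ((y + 1) / 2) (by omega) (by omega)
      have h2 := primeCounting_le_of_half (y := y) (k := 16) (by omega)
      omega

theorem primeCounting_le_fourteen {y : ℕ} (h : 3804 ≤ y) : 100 * y.primeCounting ≤ 14 * y := by
  rcases Nat.lt_or_ge y 8196 with hlt | hge
  · have := primeCounting_le_scanBound (y := y) (by omega) (by omega)
    rw [scanBound, if_neg (by omega), if_neg (by omega), if_neg (by omega),
      if_pos (by omega)] at this
    omega
  · have := primeCounting_le_thirteen hge
    omega

theorem primeCounting_le_fifteen {y : ℕ} (h : 2004 ≤ y) : 1000 * y.primeCounting ≤ 153 * y := by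
  rcases Nat.lt_or_ge y 3804 with hlt | hge
  · have := primeCounting_le_scanBound (y := y) (by omega) (by omega)
    rw [scanBound, if_neg (by omega)] at this
    split_ifs at this <;> omega
  · have := primeCounting_le_fourteen hge
    omega

theorem primeCounting_le_log {k y : ℕ} (hk : 17 ≤ k) (h : 2 ^ k ≤ y) :
    100 * (k * y.primeCounting) ≤ 227 * y := by
  induction k, hk using Nat.le_induction generalizing y with
  | base =>
    have := primeCounting_le_thirteen (y := y) (by omega)
    omega
  | succ k hk ih =>
    have h1 : 2 ^ k ≤ (y + 1) / 2 := by rw [pow_succ] at h; omega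
    have h2 := ih h1
    have h3 := primeCounting_le_of_half h
    have h4 : 100 * (k * y.primeCounting) ≤ 427 * ((y + 1) / 2) := by omega
    have h5 : 17 * ((k + 1) * y.primeCounting) ≤ 18 * (k * y.primeCounting) := by
      nlinarith [Nat.zero_le y.primeCounting]
    have h6 : 2 ^ 18 ≤ y := (Nat.pow_le_pow_right (by norm_num) (by omega)).trans h
    omega

theorem sum_inv_sq_primes_le {L M : ℕ} (hL : 0 < M) (hLM : L ≤ M) (y : ℕ) :
    ∑ p ∈ (Ioc L y).filter Nat.Prime, (1 / p ^ 2 : ℚ)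
      ≤ ∑ p ∈ (Ioc L M).filter Nat.Prime, (1 / p ^ 2 : ℚ) + 1 / M := by
  have key : ∀ d : ℕ, ∑ p ∈ (Ioc M (M + d)).filter Nat.Prime, (1 / p ^ 2 : ℚ)
      ≤ 1 / M - 1 / (M + d : ℕ) := by
    intro d
    refine (sum_le_sum_of_subset_of_nonneg (filter_subset _ _) fun _ _ _ => by positivity).trans ?_
    induction d with
    | zero => simp
    | succ d ih =>
      rw [← add_assoc, sum_Ioc_succ_top (by omega)]
      have hMd : (0 : ℚ) < (M + d : ℕ) := by positivity
      have : (1 / ((M + d + 1 : ℕ) : ℚ) ^ 2) ≤ 1 / (M + d : ℕ) - 1 / (M + d + 1 : ℕ) := by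
        push_cast at hMd ⊢
        rw [div_sub_div _ _ (by positivity) (by positivity),
          div_le_div_iff₀ (by positivity) (by positivity)]
        nlinarith
      linarith
  have hsub : (Ioc L y).filter Nat.Prime
      ⊆ (Ioc L M).filter Nat.Prime ∪ (Ioc M (M + y)).filter Nat.Prime := by
    intro p hp
    simp only [mem_union, mem_filter, mem_Ioc] at hp ⊢
    by_cases h : p ≤ M
    · exact Or.inl ⟨⟨hp.1.1, h⟩, hp.2⟩
    · exact Or.inr ⟨⟨not_le.1 h, by omega⟩, hp.2⟩
  have hdisj : Disjoint ((Ioc L M).filter Nat.Prime) ((Ioc M (M + y)).filter Nat.Prime) := by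
    rw [disjoint_left]
    intro p h1 h2
    have := (mem_Ioc.1 (mem_filter.1 h1).1).2
    have := (mem_Ioc.1 (mem_filter.1 h2).1).1
    omega
  refine (sum_le_sum_of_subset_of_nonneg hsub fun _ _ _ => by positivity).trans ?_
  rw [sum_union hdisj]
  have h0 : (0 : ℚ) ≤ 1 / (M + y : ℕ) := by positivity
  linarith [key y]

theorem sum_inv_sq_primes_two_thousand :
    ∑ p ∈ (Ioc 13 2000).filter Nat.Prime, (1 / p ^ 2 : ℚ) ≤ 1652 / 100000 := by
  obtain ⟨A, hA⟩ : ∃ A : Finset ℕ, A = (Ioc 13 2000).filter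
      (fun m => m < 44 ∧ m.Coprime 30 ∨ m.Coprime 13082761331670030) := ⟨_, rfl⟩
  have hsub : (Ioc 13 2000).filter Nat.Prime ⊆ A := by
    rw [hA]
    intro p hp
    obtain ⟨h1, h2⟩ := mem_filter.1 hp
    refine mem_filter.2 ⟨h1, ?_⟩
    have h3 := mem_Ioc.1 h1
    rw [Nat.Prime.coprime_iff_not_dvd h2, Nat.Prime.coprime_iff_not_dvd h2]
    by_cases hlt : p < 44
    · left
      refine ⟨hlt, fun h => ?_⟩
      have : p ∣ 2 * (3 * 5) := h
      have := (h2.dvd_mul.1 this).imp (Nat.le_of_dvd (by norm_num))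
        (fun h => (h2.dvd_mul.1 h).imp (Nat.le_of_dvd (by norm_num)) (Nat.le_of_dvd (by norm_num)))
      omega
    · right
      intro h
      have h4 : 13082761331670030 ∣ Nat.factorial 43 := Nat.dvd_of_mod_eq_zero (by decide +kernel)
      exact hlt (Nat.lt_succ_of_le (h2.dvd_factorial.1 (h.trans h4)))
  have hnum : ∑ m ∈ A, (10 ^ 9 / m ^ 2 + 1) ≤ 16520000 := by rw [hA]; decide +kernel
  refine (sum_le_sum_of_subset_of_nonneg hsub fun _ _ _ => by positivity).trans ?_
  have : ∑ m ∈ A, (1 / m ^ 2 : ℚ) ≤ (∑ m ∈ A, (10 ^ 9 / m ^ 2 + 1) : ℕ) / 10 ^ 9 := by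
    rw [Nat.cast_sum, sum_div]
    refine sum_le_sum fun m hm => ?_
    rw [hA] at hm
    have h3 := mem_Ioc.1 (mem_filter.1 hm).1
    rw [div_le_div_iff₀ (pow_pos (by exact_mod_cast (by omega : 0 < m)) 2) (by norm_num), one_mul]
    have := Nat.lt_div_mul_add (a := 10 ^ 9) (b := m ^ 2) (pow_pos (by omega) 2)
    have h : 10 ^ 9 ≤ (10 ^ 9 / m ^ 2 + 1) * m ^ 2 := by rw [add_mul, one_mul]; exact this.le
    exact_mod_cast h
  refine this.trans ?_
  rw [div_le_iff₀ (by norm_num)]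
  refine le_trans (Nat.cast_le.2 hnum) (by norm_num)

theorem sum_inv_sq_primes_gt_thirteen (y : ℕ) :
    ∑ p ∈ (Ioc 13 y).filter Nat.Prime, (1 / p ^ 2 : ℚ) ≤ 1702 / 100000 := by
  have := sum_inv_sq_primes_le (L := 13) (M := 2000) (by norm_num) (by norm_num) y
  have := sum_inv_sq_primes_two_thousand
  norm_num at *
  linarith

theorem sum_inv_sq_primes_gt_seven (y : ℕ) :
    ∑ p ∈ (Ioc 7 y).filter Nat.Prime, (1 / p ^ 2 : ℚ) ≤ 3121 / 100000 := by
  have hsub : (Ioc 7 y).filter Nat.Prime ⊆ {11, 13} ∪ (Ioc 13 y).filter Nat.Prime := by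
    intro p hp
    simp only [mem_union, mem_filter, mem_Ioc, mem_insert, mem_singleton] at hp ⊢
    by_cases h : p ≤ 13
    · have h2 := hp.2
      have h3 := hp.1.1
      interval_cases p <;> first | omega | exact absurd h2 (by norm_num)
    · exact Or.inr ⟨⟨by omega, hp.1.2⟩, hp.2⟩
  refine (sum_le_sum_of_subset_of_nonneg hsub fun _ _ _ => by positivity).trans ?_
  rw [sum_union (by
    rw [disjoint_left]; intro p h1 h2
    simp only [mem_filter, mem_Ioc, mem_insert, mem_singleton] at h1 h2
    omega)]
  have := sum_inv_sq_primes_gt_thirteen y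
  norm_num at *
  linarith

/-- A cheap necessary condition for being a prime, restricted to `1 mod 4` if `m4` is set. -/
def admissible (m4 : Bool) (q : ℕ) : Bool :=
  (Nat.gcd q 223092870 == 1 || (q ≤ 23 && Nat.gcd q 30 == 1) || q ≤ 5)
    && (!m4 || q % 4 == 1)

theorem admissible_of_prime {m4 : Bool} {q : ℕ} (hq : q.Prime) (h4 : m4 = true → q % 4 = 1) :
    admissible m4 q = true := by
  have h1 : (Nat.gcd q 223092870 == 1 || (q ≤ 23 && Nat.gcd q 30 == 1) || q ≤ 5) = true := by
    simp only [Bool.or_eq_true, beq_iff_eq, decide_eq_true_eq, Bool.and_eq_true]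
    by_cases h5 : q ≤ 5
    · exact Or.inr h5
    left
    have aux : ∀ P, Nat.gcd q P = 1 ↔ ¬ q ∣ P := fun P => Nat.Prime.coprime_iff_not_dvd hq
    rw [aux, aux]
    by_cases h23 : q ≤ 23
    · right
      refine ⟨h23, fun h => ?_⟩
      have : 30 ∣ Nat.factorial 5 := by decide
      exact h5 (hq.dvd_factorial.1 (h.trans this))
    · left
      intro h
      have : 223092870 ∣ Nat.factorial 23 := by decide +kernel
      exact h23 (hq.dvd_factorial.1 (h.trans this))
  rw [admissible, h1]
  cases m4
  · rfl
  · simp [h4 rfl]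

/-- Number of elements and (scaled) sum of reciprocals of the shortest initial segment
of the admissible numbers that cannot be extended below the product bound `b`. -/
def tailSearch (m4 : Bool) (b : ℕ) : ℕ → ℕ → ℕ → ℕ → ℕ → Option (ℕ × ℕ)
  | 0, _, _, _, _ => none
  | f + 1, w, P, t, s =>
    if b < w * P then some (t, s)
    else bif admissible m4 w then tailSearch m4 b f (w + 1) (P * w) (t + 1) (s + (10 ^ 9 / w + 1))
    else tailSearch m4 b f (w + 1) P t s

theorem tailSearch_spec {m4 : Bool} {b L : ℕ} {A : Finset ℕ}
    (hA : ∀ q ∈ A, L < q ∧ admissible m4 q = true) (hb : ∏ q ∈ A, q ≤ b) {T S : ℕ} :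
    ∀ f w P t s : ℕ, L < w → P = ∏ q ∈ (Ioo L w).filter (admissible m4 ·), q →
      ((Ioo L w).filter (admissible m4 ·)).card = t →
      ∑ q ∈ (Ioo L w).filter (admissible m4 ·), (1 / q : ℚ) ≤ s / 10 ^ 9 →
      tailSearch m4 b f w P t s = some (T, S) →
      A.card ≤ T ∧ ∑ q ∈ A, (1 / q : ℚ) ≤ S / 10 ^ 9 := by
  intro f
  induction f with
  | zero => intro w P t s _ _ _ _ h; simp [tailSearch] at h
  | succ f ih =>
    intro w P t s hw hP ht hs h
    have hins : Ioo L (w + 1) = insert w (Ioo L w) := by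
      ext x; simp only [mem_Ioo, mem_insert]; omega
    rw [tailSearch] at h
    split_ifs at h with hlt
    · simp only [Option.some.injEq, Prod.mk.injEq] at h
      obtain ⟨rfl, rfl⟩ := h
      rw [hP] at hlt
      have := card_le_and_sum_inv_le (A := A) (T := (Ioo L w).filter (admissible m4 ·))
        (w := w) (by omega)
        (fun q hq => by have := mem_Ioo.1 (mem_filter.1 hq).1; omega)
        (fun q hq hqw => mem_filter.2 ⟨mem_Ioo.2 ⟨(hA q hq).1, hqw⟩, (hA q hq).2⟩)
        (fun q hq => by have := (hA q hq).1; omega) (hb.trans_lt hlt)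
      exact ⟨this.1.trans_eq ht, this.2.trans hs⟩
    · cases hadm : admissible m4 w with
      | false =>
        rw [hadm, cond_false] at h
        refine ih (w + 1) P t s (by omega) ?_ ?_ ?_ h <;>
          rw [hins, filter_insert, if_neg (by simp [hadm])] <;> assumption
      | true =>
        rw [hadm, cond_true] at h
        have hnot : w ∉ (Ioo L w).filter (admissible m4 ·) := by simp
        refine ih (w + 1) _ _ _ (by omega) ?_ ?_ ?_ h
        · rw [hins, filter_insert, if_pos hadm, prod_insert hnot, hP, mul_comm]
        · rw [hins, filter_insert, if_pos hadm, card_insert_of_notMem hnot, ht]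
        · rw [hins, filter_insert, if_pos hadm, sum_insert hnot]
          have hw0 : (0 : ℚ) < w := by exact_mod_cast (by omega : 0 < w)
          have h1 : (1 / w : ℚ) ≤ ((10 ^ 9 / w + 1 : ℕ) : ℚ) / 10 ^ 9 := by
            rw [div_le_div_iff₀ hw0 (by norm_num), one_mul]
            have := Nat.lt_div_mul_add (a := 10 ^ 9) (b := w) (by omega)
            have h : 10 ^ 9 ≤ (10 ^ 9 / w + 1) * w := by rw [add_mul, one_mul]; exact this.le
            exact_mod_cast h
          have e : ((s + (10 ^ 9 / w + 1) : ℕ) : ℚ) / 10 ^ 9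
            = s / 10 ^ 9 + ((10 ^ 9 / w + 1 : ℕ) : ℚ) / 10 ^ 9 := by
            rw [Nat.cast_add, add_div]
          rw [e]
          linarith

theorem lt_mul_of_margin {π Φ K N s t a b f M : ℚ} (hK : 0 ≤ K) (hΦ : 0 ≤ Φ) (ht : 0 ≤ t)
    (hb : 0 ≤ b) (hf : 0 ≤ f) (hN : 0 ≤ N) (h : K + Φ * (1 + (t + b) + 2 * f) < N * (M - K))
    (hπ : π ≤ K * (s + 1)) (ha : a ≤ t) (hs : N ≤ s) :
    π + Φ * (1 + (a + b) + 2 * f) < s * M := by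
  have hMK : 0 ≤ M - K := by
    by_contra! hneg
    have h1 : N * (M - K) ≤ 0 := mul_nonpos_of_nonneg_of_nonpos hN hneg.le
    have h2 : 0 ≤ K + Φ * (1 + (t + b) + 2 * f) := by positivity
    linarith
  have h1 : N * (M - K) ≤ s * (M - K) := mul_le_mul_of_nonneg_right hs hMK
  have h2 : Φ * (1 + (a + b) + 2 * f) ≤ Φ * (1 + (t + b) + 2 * f) := by gcongr
  linarith

/-- The numerical inequality behind the sieve when exactly the primes of `D` among `P₀` divide `n`;
`d` is the number of residues used modulo `18`, `e` is `3` or `1` according as `3 ∣ n` or not. -/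
def patternCheck (d e : ℕ) (m4 : Bool) (K σ : ℚ) (N hi cut L : ℕ) (P₀ D : Finset ℕ) : Bool :=
  match tailSearch m4 (hi / (e * ∏ q ∈ D, q)) 1000 (L + 1) 1 0 0 with
  | none => false
  | some (t, s) =>
    let Φ := d * ∏ q ∈ D.filter (· ≤ cut), (q - 1)
    let R : ℚ := s / 10 ^ 9 + ∑ q ∈ D.filter (cut < ·), (1 / q : ℚ) + ∑ l ∈ P₀ \ D, (2 / l ^ 2 : ℚ)
    decide (K + Φ * (1 + (t + (D.filter (cut < ·)).card : ℕ) + 2 * (P₀ \ D).card)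
      < N * ((Φ : ℚ) / (18 * ∏ q ∈ D.filter (· ≤ cut), q : ℕ) * (1 - R) - σ - K))

theorem exists_primitive_of_patternCheck {n y d e N hi cut L : ℕ} {m4 : Bool} {K σ : ℚ}
    {P₀ : Finset ℕ} (hL : 5 ≤ L) (hN : N ^ 2 ≤ n) (hhi : n ≤ hi) (hK : 0 ≤ K)
    (hP₀ : ∀ p ∈ P₀, p.Prime ∧ 5 ≤ p ∧ p ≤ L) (hP₀L : ∀ p, p.Prime → 5 ≤ p → p ≤ L → p ∈ P₀)
    (hd : d = if 3 ∣ n then 6 else 7) (he : e = if 3 ∣ n then 3 else 1)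
    (h4 : m4 = true → ∀ p, p.Prime → p ∣ n → 5 ≤ p → p % 4 = 1)
    (hy : ∀ x p, p.Prime → x ^ 2 < n → x.Coprime n → p ^ 2 ∣ n - x ^ 2 → x % 2 ≠ n % 2 → p ≤ y)
    (hπ : (y.primeCounting : ℚ) ≤ K * (Nat.sqrt n + 1))
    (hσ : ∑ p ∈ (Ioc L y).filter Nat.Prime, (1 / p ^ 2 : ℚ) ≤ σ)
    (hcheck : ∀ D ∈ P₀.powerset, (m4 = true → ∀ q ∈ D, q % 4 = 1) →
      patternCheck d e m4 K σ N hi cut L P₀ D = true) :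
    ∃ x : ℕ, x ^ 2 ≤ n ∧ x.Coprime n ∧ Squarefree (n - x ^ 2) := by
  rcases Nat.eq_zero_or_pos n with rfl | hn
  · have hN0 : N = 0 := by simpa using hN
    subst hN0
    have := hcheck ∅ (by simp) (by simp)
    rw [patternCheck] at this
    split at this
    · simp at this
    · simp only [decide_eq_true_eq, Nat.cast_zero, zero_mul] at this
      exact absurd this (not_lt.2 (by positivity))
  set D := P₀.filter (· ∣ n) with hD
  set A := n.primeFactors.filter (L < ·) with hA
  have hDp : ∀ q ∈ D, q.Prime ∧ 5 ≤ q ∧ q ≤ L ∧ q ∣ n := fun q hq =>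
    have h := mem_filter.1 hq
    ⟨(hP₀ q h.1).1, (hP₀ q h.1).2.1, (hP₀ q h.1).2.2, h.2⟩
  have hAp : ∀ q ∈ A, q.Prime ∧ L < q ∧ q ∣ n := fun q hq =>
    have h := mem_filter.1 hq
    ⟨Nat.prime_of_mem_primeFactors h.1, h.2, Nat.dvd_of_mem_primeFactors h.1⟩
  have hsdiff : P₀ \ D = P₀.filter (fun l => ¬ l ∣ n) := by rw [hD, filter_not]
  have hprod : e * (∏ q ∈ D, q) * ∏ q ∈ A, q ≤ n := by
    refine Nat.le_of_dvd hn ?_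
    set E : Finset ℕ := if 3 ∣ n then {3} else ∅ with hE
    have hEe : e = ∏ q ∈ E, q := by rw [he, hE]; split_ifs <;> simp
    have hE3 : ∀ q ∈ E, q = 3 ∧ 3 ∣ n := by
      intro q hq; rw [hE] at hq; split_ifs at hq with h <;> simp_all
    rw [hEe, ← prod_union (by
        rw [disjoint_left]; intro q h1 h2
        have := (hE3 q h1).1
        have := (hDp q h2).2.1
        omega), ← prod_union (by
        rw [disjoint_left]; intro q h1 h2
        have := (hAp q h2).2.1
        rcases mem_union.1 h1 with h | h
        · have := (hE3 q h).1; omega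
        · have := (hDp q h).2.2.1; omega)]
    refine (prod_dvd_prod_of_subset _ _ _ fun q hq => ?_).trans (Nat.prod_primeFactors_dvd n)
    rw [Nat.mem_primeFactors]
    rcases mem_union.1 hq with h | h
    · rcases mem_union.1 h with h | h
      · obtain ⟨rfl, h3⟩ := hE3 q h
        exact ⟨Nat.prime_three, h3, hn.ne'⟩
      · exact ⟨(hDp q h).1, (hDp q h).2.2.2, hn.ne'⟩
    · exact ⟨(hAp q h).1, (hAp q h).2.2, hn.ne'⟩
  have hpos : 0 < e * ∏ q ∈ D, q := by
    refine Nat.mul_pos (by rw [he]; split_ifs <;> norm_num) (prod_pos fun q hq => (hDp q hq).1.pos)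
  have hAb : ∏ q ∈ A, q ≤ hi / (e * ∏ q ∈ D, q) := by
    rw [Nat.le_div_iff_mul_le hpos, mul_comm]; exact hprod.trans hhi
  have hc := hcheck D (mem_powerset.2 (filter_subset _ _))
    fun hm q hq => h4 hm q (hDp q hq).1 (hDp q hq).2.2.2 (hDp q hq).2.1
  rw [patternCheck] at hc
  rcases hts : tailSearch m4 (hi / (e * ∏ q ∈ D, q)) 1000 (L + 1) 1 0 0 with _ | ⟨t, s⟩
  · rw [hts] at hc; simp at hc
  rw [hts] at hc
  simp only [decide_eq_true_eq] at hc
  have hemp : Ioo L (L + 1) = ∅ := eq_empty_of_forall_notMem fun x hx => by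
    have := mem_Ioo.1 hx
    omega
  obtain ⟨hcard, hsum⟩ := tailSearch_spec (L := L) (A := A)
    (fun q hq => ⟨(hAp q hq).2.1, admissible_of_prime (hAp q hq).1 fun hm =>
      h4 hm q (hAp q hq).1 (hAp q hq).2.2 (by have := (hAp q hq).2.1; omega)⟩) hAb
    1000 (L + 1) 1 0 0 (by omega) (by simp [hemp]) (by simp [hemp]) (by simp [hemp]) hts
  have hdisj : Disjoint A (D.filter (cut < ·)) := by
    rw [disjoint_left]; intro q h1 h2
    have := (hAp q h1).2.1
    have := (hDp q (mem_filter.1 h2).1).2.2.1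
    omega
  refine exists_primitive_of_sieve (y := y) (L := L) (σ := σ)
    (R := s / 10 ^ 9 + ∑ q ∈ D.filter (cut < ·), (1 / q : ℚ) + ∑ l ∈ P₀ \ D, (2 / l ^ 2 : ℚ))
    (S := D.filter (· ≤ cut)) (Q := A ∪ D.filter (cut < ·)) (F := P₀ \ D)
    (fun q hq => have h := hDp q (mem_filter.1 hq).1; ⟨h.1, h.2.1, h.2.2.2⟩) ?_ ?_ ?_ ?_ hy hσ ?_ ?_
  · intro q hq
    rcases mem_union.1 hq with h | h
    · have h1 := hAp q h
      refine ⟨h1.1, by omega, fun h2 => ?_⟩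
      have := (hDp q (mem_filter.1 h2).1).2.2.1
      omega
    · have h1 := mem_filter.1 h
      refine ⟨(hDp q h1.1).1, (hDp q h1.1).2.1, fun h2 => ?_⟩
      have := (mem_filter.1 h2).2
      omega
  · intro p hp h5 hpn hpS
    by_cases hpL : p ≤ L
    · have hpD : p ∈ D := mem_filter.2 ⟨hP₀L p hp h5 hpL, hpn⟩
      refine mem_union_right _ (mem_filter.2 ⟨hpD, ?_⟩)
      by_contra h
      exact hpS (mem_filter.2 ⟨hpD, not_lt.1 h⟩)
    · exact mem_union_left _ (mem_filter.2
        ⟨Nat.mem_primeFactors.2 ⟨hp, hpn, hn.ne'⟩, not_le.1 hpL⟩)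
  · intro l hl
    rw [hsdiff] at hl
    have h := mem_filter.1 hl
    exact ⟨(hP₀ l h.1).1, (hP₀ l h.1).2.1, h.2⟩
  · intro p hp h5 hpL hpn
    rw [hsdiff]
    exact mem_filter.2 ⟨hP₀L p hp h5 hpL, hpn⟩
  · rw [sum_union hdisj]
    linarith
  · rw [← hd, card_union_of_disjoint hdisj]
    rw [Nat.cast_add] at hc ⊢
    exact lt_mul_of_margin hK (Nat.cast_nonneg _) (Nat.cast_nonneg _) (Nat.cast_nonneg _)
      (Nat.cast_nonneg _) (Nat.cast_nonneg _) hc hπ (Nat.cast_le.2 hcard)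
      (Nat.cast_le.2 (Nat.le_sqrt'.2 hN))

theorem le_mul_sqrt_add_one {n k : ℕ} {κ : ℚ} (hκ : 0 ≤ κ) (h : 1 ≤ κ ^ 2 * k) :
    (Nat.sqrt (n / k) : ℚ) ≤ κ * (Nat.sqrt n + 1) := by
  have h1 : Nat.sqrt (n / k) ^ 2 * k < (Nat.sqrt n + 1) ^ 2 :=
    (Nat.mul_le_mul_right k (Nat.sqrt_le' (n / k))).trans_lt
      ((Nat.div_mul_le_self n k).trans_lt (Nat.lt_succ_sqrt' n))
  have h2 : (Nat.sqrt (n / k) : ℚ) ^ 2 * k ≤ (Nat.sqrt n + 1) ^ 2 := by exact_mod_cast h1.le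
  refine (sq_le_sq₀ (by positivity) (by positivity)).1 ?_
  calc (Nat.sqrt (n / k) : ℚ) ^ 2 ≤ Nat.sqrt (n / k) ^ 2 * (κ ^ 2 * k) :=
        le_mul_of_one_le_right (by positivity) h
    _ = κ ^ 2 * (Nat.sqrt (n / k) ^ 2 * k) := by ring
    _ ≤ κ ^ 2 * (Nat.sqrt n + 1) ^ 2 := by gcongr
    _ = (κ * (Nat.sqrt n + 1)) ^ 2 := by ring

theorem exists_primitive_of_rowCheck {n N hi cut L : ℕ} {c₁ c₃ c₅ σ : ℚ} {P₀ : Finset ℕ}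
    (hL : 5 ≤ L) (hN : N ^ 2 ≤ n) (hhi : n ≤ hi) (hc₁ : 0 ≤ c₁) (hc₃ : 0 ≤ c₃) (hc₅ : 0 ≤ c₅)
    (hP₀ : ∀ p ∈ P₀, p.Prime ∧ 5 ≤ p ∧ p ≤ L) (hP₀L : ∀ p, p.Prime → 5 ≤ p → p ≤ L → p ∈ P₀)
    (hπ₁ : ∀ y, n < 1 * (y + 1) ^ 2 → (y.primeCounting : ℚ) ≤ c₁ * y)
    (hπ₃ : ∀ y, n < 3 * (y + 1) ^ 2 → (y.primeCounting : ℚ) ≤ c₃ * y)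
    (hπ₅ : ∀ y, n < 5 * (y + 1) ^ 2 → (y.primeCounting : ℚ) ≤ c₅ * y)
    (hσ : ∀ y, ∑ p ∈ (Ioc L y).filter Nat.Prime, (1 / p ^ 2 : ℚ) ≤ σ)
    (hthree : ∀ D ∈ P₀.powerset,
      patternCheck 6 3 false (c₅ * (44722 / 100000)) σ N hi cut L P₀ D = true)
    (hodd : ∀ D ∈ P₀.powerset,
      patternCheck 7 1 false (c₃ * (57736 / 100000)) σ N hi cut L P₀ D = true)
    (hone : ∀ D ∈ P₀.powerset, (∀ q ∈ D, q % 4 = 1) →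
      patternCheck 7 1 true c₁ σ N hi cut L P₀ D = true) :
    ∃ x : ℕ, x ^ 2 ≤ n ∧ x.Coprime n ∧ Squarefree (n - x ^ 2) := by
  have key : ∀ (k : ℕ) (κ c : ℚ), 0 < k → 0 ≤ κ → 0 ≤ c → 1 ≤ κ ^ 2 * k →
      (∀ y, n < k * (y + 1) ^ 2 → (y.primeCounting : ℚ) ≤ c * y) →
      ((Nat.sqrt (n / k)).primeCounting : ℚ) ≤ c * κ * (Nat.sqrt n + 1) := by
    intro k κ c hk hκ hc h hπ
    have hYk : n < k * (Nat.sqrt (n / k) + 1) ^ 2 := by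
      rw [mul_comm, ← Nat.div_lt_iff_lt_mul hk]
      exact Nat.lt_succ_sqrt' _
    calc ((Nat.sqrt (n / k)).primeCounting : ℚ) ≤ c * Nat.sqrt (n / k) := hπ _ hYk
      _ ≤ c * (κ * (Nat.sqrt n + 1)) := mul_le_mul_of_nonneg_left (le_mul_sqrt_add_one hκ h) hc
      _ = _ := by ring
  by_cases h3 : 3 ∣ n
  · exact exists_primitive_of_patternCheck hL hN hhi (by positivity) hP₀ hP₀L
      (by rw [if_pos h3]) (by rw [if_pos h3]) (by simp)
      (fun x p hp hx hxn hd hpar => prime_le_sqrt_div_five h3 hx hxn hpar hd)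
      (key 5 _ _ (by norm_num) (by norm_num) hc₅ (by norm_num) hπ₅) (hσ _)
      fun D hD _ => hthree D hD
  by_cases hq : ∃ q, q.Prime ∧ q % 4 = 3 ∧ q ∣ n
  · obtain ⟨q, hq, hq4, hqn⟩ := hq
    exact exists_primitive_of_patternCheck hL hN hhi (by positivity) hP₀ hP₀L
      (by rw [if_neg h3]) (by rw [if_neg h3]) (by simp)
      (fun x p hp hx hxn hd hpar => prime_le_sqrt_div_three hq hq4 hqn hx hxn hpar hd)
      (key 3 _ _ (by norm_num) (by norm_num) hc₃ (by norm_num) hπ₃) (hσ _)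
      fun D hD _ => hodd D hD
  · push Not at hq
    refine exists_primitive_of_patternCheck (m4 := true) hL hN hhi hc₁ hP₀ hP₀L
      (by rw [if_neg h3]) (by rw [if_neg h3]) (fun _ p hp hpn h5 => ?_)
      (fun x p hp hx hxn hd hpar => prime_le_sqrt hx hpar hd)
      (by simpa using key 1 1 _ (by norm_num) (by norm_num) hc₁ (by norm_num) hπ₁) (hσ _)
      fun D hD h => hone D hD (h rfl)
    have h1 : p % 4 ≠ 3 := fun h => hq p hp h hpn
    have h2 := hp.eq_two_or_odd
    omega

theorem mem_pair_of_le_seven {p : ℕ} (hp : p.Prime) (h5 : 5 ≤ p) (h7 : p ≤ 7) :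
    p ∈ ({5, 7} : Finset ℕ) := by
  interval_cases p <;> first | decide | exact absurd hp (by norm_num)

theorem mem_of_le_thirteen {p : ℕ} (hp : p.Prime) (h5 : 5 ≤ p) (h13 : p ≤ 13) :
    p ∈ ({5, 7, 11, 13} : Finset ℕ) := by
  interval_cases p <;> first | decide | exact absurd hp (by norm_num)

theorem exists_primitive_of_le_seven_hundred_million {n : ℕ} (hlo : 25 * 10 ^ 6 ≤ n)
    (hhi : n ≤ 7 * 10 ^ 8) : ∃ x : ℕ, x ^ 2 ≤ n ∧ x.Coprime n ∧ Squarefree (n - x ^ 2) := by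
  refine exists_primitive_of_rowCheck (N := 5000) (hi := 7 * 10 ^ 8) (cut := 5) (L := 7)
    (c₁ := 14 / 100) (c₃ := 153 / 1000) (c₅ := 153 / 1000) (P₀ := {5, 7}) (by norm_num)
    (by omega) hhi (by norm_num) (by norm_num) (by norm_num) (by simp; norm_num)
    (fun p => mem_pair_of_le_seven) (fun y hy => ?_) (fun y hy => ?_) (fun y hy => ?_)
    sum_inv_sq_primes_gt_seven (by decide +kernel) (by decide +kernel) (by decide +kernel)
  · have := primeCounting_le_fourteen (y := y) (by nlinarith)
    have : (100 * y.primeCounting : ℚ) ≤ 14 * y := by exact_mod_cast this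
    linarith
  · have := primeCounting_le_fifteen (y := y) (by nlinarith)
    have : (1000 * y.primeCounting : ℚ) ≤ 153 * y := by exact_mod_cast this
    linarith
  · have := primeCounting_le_fifteen (y := y) (by nlinarith)
    have : (1000 * y.primeCounting : ℚ) ≤ 153 * y := by exact_mod_cast this
    linarith

theorem exists_primitive_of_le_eight_pow_sixteen {n : ℕ} (hlo : 7 * 10 ^ 8 ≤ n)
    (hhi : n ≤ 8 * 10 ^ 16) : ∃ x : ℕ, x ^ 2 ≤ n ∧ x.Coprime n ∧ Squarefree (n - x ^ 2) := by
  have hπ : ∀ k y, k ≤ 5 → n < k * (y + 1) ^ 2 → (y.primeCounting : ℚ) ≤ 13 / 100 * y := by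
    intro k y hk h
    have := primeCounting_le_thirteen (y := y)
      (by have := Nat.mul_le_mul_right ((y + 1) ^ 2) hk; nlinarith)
    have : (100 * y.primeCounting : ℚ) ≤ 13 * y := by exact_mod_cast this
    linarith
  exact exists_primitive_of_rowCheck (N := 26457) (hi := 8 * 10 ^ 16) (cut := 5) (L := 7)
    (c₁ := 13 / 100) (c₃ := 13 / 100) (c₅ := 13 / 100) (P₀ := {5, 7}) (by norm_num)
    (by omega) hhi (by norm_num) (by norm_num) (by norm_num) (by simp; norm_num)
    (fun p => mem_pair_of_le_seven) (hπ 1 · (by norm_num)) (hπ 3 · (by norm_num))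
    (hπ 5 · (by norm_num))
    sum_inv_sq_primes_gt_seven (by decide +kernel) (by decide +kernel) (by decide +kernel)

theorem exists_primitive_of_le_ten_pow_hundred {n : ℕ} (hlo : 8 * 10 ^ 16 ≤ n)
    (hhi : n ≤ 10 ^ 100) : ∃ x : ℕ, x ^ 2 ≤ n ∧ x.Coprime n ∧ Squarefree (n - x ^ 2) := by
  have hπ : ∀ k y, k ≤ 5 → n < k * (y + 1) ^ 2 → (y.primeCounting : ℚ) ≤ 227 / 2600 * y := by
    intro k y hk h
    have := primeCounting_le_log (k := 26) (y := y) (by norm_num)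
      (by have := Nat.mul_le_mul_right ((y + 1) ^ 2) hk; nlinarith)
    have : (100 * (26 * y.primeCounting) : ℚ) ≤ 227 * y := by exact_mod_cast this
    linarith
  exact exists_primitive_of_rowCheck (N := 28 * 10 ^ 7) (hi := 10 ^ 100) (cut := 13) (L := 13)
    (c₁ := 227 / 2600) (c₃ := 227 / 2600) (c₅ := 227 / 2600) (P₀ := {5, 7, 11, 13}) (by norm_num)
    (by omega) hhi (by norm_num) (by norm_num) (by norm_num) (by simp; norm_num)
    (fun p => mem_of_le_thirteen) (hπ 1 · (by norm_num)) (hπ 3 · (by norm_num))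
    (hπ 5 · (by norm_num))
    sum_inv_sq_primes_gt_thirteen (by decide +kernel) (by decide +kernel) (by decide +kernel)

theorem two_mul_card_add_two_le {A : Finset ℕ} {a : ℕ} (ha : 2 ≤ a)
    (hA : ∀ q ∈ A, q % 2 = 1 ∧ 5 ≤ q ∧ q ≤ a) : 2 * A.card + 2 ≤ a := by
  have h : A.card ≤ (Icc 2 (a / 2)).card := by
    refine card_le_card_of_injOn (· / 2) (fun q hq => ?_) (fun p hp q hq h => ?_)
    · have := hA q hq
      simp only [coe_Icc, Set.mem_Icc]
      omega
    · have := hA p hp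
      have := hA q hq
      simp only at h
      omega
  rw [Nat.card_Icc] at h
  omega

theorem three_mul_card_le {A : Finset ℕ} {a : ℕ}
    (hA : ∀ q ∈ A, q % 2 = 1 ∧ q % 3 ≠ 0 ∧ 5 ≤ q ∧ q ≤ a) : 3 * A.card ≤ a := by
  have h : A.card ≤ (Icc 1 (a / 3)).card := by
    refine card_le_card_of_injOn (· / 3) (fun q hq => ?_) (fun p hp q hq h => ?_)
    · have := hA q hq
      simp only [coe_Icc, Set.mem_Icc]
      omega
    · have := hA p hp
      have := hA q hq
      simp only at h
      omega
  rw [Nat.card_Icc] at h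
  omega

theorem three_div_le_sq_prod {A : Finset ℕ} (hA : ∀ q ∈ A, q % 2 = 1 ∧ 5 ≤ q) :
    (3 / (2 * A.card + 3) : ℚ) ≤ (∏ q ∈ A, (1 - 1 / q : ℚ)) ^ 2 := by
  induction A using Finset.induction_on_max with
  | empty => simp
  | insert a A hlt ih =>
    have hnot : a ∉ A := fun h => lt_irrefl _ (hlt a h)
    have ha := hA a (mem_insert_self _ _)
    have hle := two_mul_card_add_two_le (A := insert a A) (a := a) (by omega) fun q hq => by
      refine ⟨(hA q hq).1, (hA q hq).2, ?_⟩
      rcases mem_insert.1 hq with rfl | h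
      · exact le_rfl
      · exact (hlt q h).le
    rw [card_insert_of_notMem hnot] at hle ⊢
    have hra : ((2 * A.card + 5 : ℕ) : ℚ) ≤ a := by exact_mod_cast (by omega)
    rw [prod_insert hnot, mul_pow]
    set r : ℚ := (A.card : ℚ) with hr
    have hr0 : 0 ≤ r := Nat.cast_nonneg _
    push_cast at hra ⊢
    have h1 : (1 - 1 / (2 * r + 5)) ^ 2 ≤ (1 - 1 / (a : ℚ)) ^ 2 := by
      refine pow_le_pow_left₀ ?_ (sub_le_sub_left (one_div_le_one_div_of_le (by positivity) hra) _) 2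
      rw [sub_nonneg, div_le_one (by positivity)]
      linarith
    have h2 : (2 * r + 3) / (2 * r + 5) ≤ (1 - 1 / (2 * r + 5)) ^ 2 := by
      rw [one_sub_div (by positivity), div_pow, div_le_div_iff₀ (by positivity) (by positivity)]
      nlinarith
    have ih' := ih fun q hq => hA q (mem_insert_of_mem hq)
    calc 3 / (2 * (r + 1) + 3) = (2 * r + 3) / (2 * r + 5) * (3 / (2 * r + 3)) := by
          field_simp; ring
      _ ≤ _ := mul_le_mul (h2.trans h1) ih' (by positivity) (by positivity)

theorem exists_initial_segment (T : Finset ℕ) {X : ℕ} (hX : 1 ≤ X) :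
    ∃ S ⊆ T, ∏ q ∈ S, q ≤ X ∧ (∀ p ∈ S, ∀ q ∈ T \ S, p < q) ∧
      ∀ q ∈ T \ S, X < q * ∏ p ∈ S, p := by
  induction T using Finset.induction_on_max with
  | empty => exact ⟨∅, by simp, by simpa using hX, by simp, by simp⟩
  | insert a T hlt ih =>
    obtain ⟨S, hST, hSX, hS, hq⟩ := ih
    have hnot : a ∉ T := fun h => lt_irrefl _ (hlt a h)
    by_cases h : T ⊆ S ∧ a * ∏ p ∈ S, p ≤ X
    · have hTS : S = T := subset_antisymm hST h.1
      refine ⟨insert a T, le_rfl, ?_, by simp, by simp⟩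
      rw [prod_insert hnot, ← hTS]
      exact h.2
    · refine ⟨S, hST.trans (subset_insert _ _), hSX, fun p hp q hq' => ?_, fun q hq' => ?_⟩ <;>
        rcases mem_sdiff.1 hq' with ⟨h1, h2⟩ <;> rcases mem_insert.1 h1 with rfl | h1
      · exact hlt p (hST hp)
      · exact hS p hp q (mem_sdiff.2 ⟨h1, h2⟩)
      · by_cases hTS : T ⊆ S
        · exact not_le.1 fun h' => h ⟨hTS, h'⟩
        · obtain ⟨b, hbT, hbS⟩ := not_subset.1 hTS
          exact (hq b (mem_sdiff.2 ⟨hbT, hbS⟩)).trans_le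
            (Nat.mul_le_mul_right _ (hlt b hbT).le)
      · exact hq q (mem_sdiff.2 ⟨h1, h2⟩)

theorem two_mul_card_tail_le {S Q : Finset ℕ} {X n q : ℕ} (hn : n ^ 2 < X ^ 5)
    (hS : ∀ p ∈ S, p ≤ q) (hQ : ∀ p ∈ Q, q ≤ p) (hX : X < q * ∏ p ∈ S, p) (hq : 0 < q)
    (h : (∏ p ∈ S, p) * ∏ p ∈ Q, p ≤ n) : 2 * Q.card ≤ 3 * S.card + 4 := by
  by_contra! hlt
  have h1 : q ^ Q.card ≤ ∏ p ∈ Q, p := by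
    rw [← prod_const]; exact prod_le_prod' hQ
  have h2 : X ≤ q ^ (S.card + 1) := by
    rw [pow_succ']
    refine hX.le.trans (Nat.mul_le_mul_left _ ?_)
    rw [← prod_const]; exact prod_le_prod' hS
  refine absurd hn (not_lt.2 ?_)
  calc X ^ 5 = X ^ 2 * X ^ 3 := by ring
    _ ≤ (q * ∏ p ∈ S, p) ^ 2 * (q ^ (S.card + 1)) ^ 3 :=
        Nat.mul_le_mul (Nat.pow_le_pow_left hX.le 2) (Nat.pow_le_pow_left h2 3)
    _ = (∏ p ∈ S, p) ^ 2 * q ^ (3 * S.card + 5) := by ring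
    _ ≤ (∏ p ∈ S, p) ^ 2 * q ^ (2 * Q.card) :=
        Nat.mul_le_mul_left _ (Nat.pow_le_pow_right hq hlt)
    _ = ((∏ p ∈ S, p) * q ^ Q.card) ^ 2 := by ring
    _ ≤ n ^ 2 := Nat.pow_le_pow_left ((Nat.mul_le_mul_left _ h1).trans h) 2

theorem pow_mul_le_two_pow {k : ℕ} (hk : 166 ≤ k) : (1000 * k ^ 2) ^ 5 * 256 ≤ 2 ^ k := by
  induction k, hk using Nat.le_induction with
  | base => norm_num
  | succ k hk ih =>
    have h1 : 14 ^ 10 * (k + 1) ^ 10 ≤ 15 ^ 10 * k ^ 10 := by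
      rw [← mul_pow, ← mul_pow]; exact Nat.pow_le_pow_left (by omega) 10
    have h2 : (k + 1) ^ 10 ≤ 2 * k ^ 10 := by omega
    calc (1000 * (k + 1) ^ 2) ^ 5 * 256 = 1000 ^ 5 * 256 * (k + 1) ^ 10 := by ring
      _ ≤ 1000 ^ 5 * 256 * (2 * k ^ 10) := Nat.mul_le_mul_left _ h2
      _ = (1000 * k ^ 2) ^ 5 * 256 * 2 := by ring
      _ ≤ 2 ^ k * 2 := Nat.mul_le_mul_right _ ih
      _ = 2 ^ (k + 1) := (pow_succ _ _).symm

theorem two_pow_mul_le {k j : ℕ} (hk : 166 ≤ k) (hj : 5 * j ≤ 4 * k + 8) :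
    1000 * k ^ 2 * 2 ^ j ≤ 2 ^ k := by
  refine (Nat.pow_le_pow_iff_left (n := 5) (by norm_num)).1 ?_
  calc (1000 * k ^ 2 * 2 ^ j) ^ 5 = (1000 * k ^ 2) ^ 5 * 2 ^ (5 * j) := by ring
    _ ≤ (1000 * k ^ 2) ^ 5 * 2 ^ (4 * k + 8) :=
        Nat.mul_le_mul_left _ (Nat.pow_le_pow_right (by norm_num) hj)
    _ = (1000 * k ^ 2) ^ 5 * 256 * 2 ^ (4 * k) := by ring
    _ ≤ 2 ^ k * 2 ^ (4 * k) := Nat.mul_le_mul_right _ (pow_mul_le_two_pow hk)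
    _ = (2 ^ k) ^ 5 := by ring

theorem sixteen_mul_card_le {S : Finset ℕ} {j : ℕ} (hS : ∀ q ∈ S, 5 ≤ q)
    (h : ∏ q ∈ S, q ≤ 2 ^ j) : 16 * S.card ≤ 7 * j := by
  have h1 : 5 ^ S.card ≤ 2 ^ j := by
    refine le_trans ?_ h
    rw [← prod_const]; exact prod_le_prod' hS
  refine (Nat.pow_le_pow_iff_right (a := 2) (by norm_num)).1 ?_
  calc 2 ^ (16 * S.card) = (2 ^ 16) ^ S.card := pow_mul _ _ _
    _ ≤ (5 ^ 7) ^ S.card := Nat.pow_le_pow_left (by norm_num) _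
    _ = (5 ^ S.card) ^ 7 := by rw [← pow_mul, ← pow_mul, mul_comm]
    _ ≤ (2 ^ j) ^ 7 := Nat.pow_le_pow_left h1 7
    _ = 2 ^ (7 * j) := by rw [← pow_mul, mul_comm]

theorem sum_two_div_sq_le {L : ℕ} {F : Finset ℕ} (hF : ∀ l ∈ F, l.Prime ∧ 5 ≤ l ∧ l ≤ L) :
    ∑ l ∈ F, (2 / l ^ 2 : ℚ) ≤ 1833 / 10000 := by
  have hsub : F ⊆ {5, 7} ∪ (Ioc 7 L).filter Nat.Prime := by
    intro l hl
    obtain ⟨hl, h5, hL⟩ := hF l hl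
    rw [mem_union]
    rcases Nat.lt_or_ge 7 l with h | h
    · exact Or.inr (mem_filter.2 ⟨mem_Ioc.2 ⟨h, hL⟩, hl⟩)
    · exact Or.inl (mem_pair_of_le_seven hl h5 h)
  have h1 := sum_inv_sq_primes_gt_seven L
  have h2 : ∑ l ∈ (Ioc 7 L).filter Nat.Prime, (2 / l ^ 2 : ℚ)
      = 2 * ∑ l ∈ (Ioc 7 L).filter Nat.Prime, (1 / l ^ 2 : ℚ) := by
    rw [mul_sum]; exact sum_congr rfl fun _ _ => by ring
  calc ∑ l ∈ F, (2 / l ^ 2 : ℚ) ≤ ∑ l ∈ {5, 7} ∪ (Ioc 7 L).filter Nat.Prime, (2 / l ^ 2 : ℚ) :=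
        sum_le_sum_of_subset_of_nonneg hsub fun _ _ _ => by positivity
    _ ≤ ∑ l ∈ ({5, 7} : Finset ℕ), (2 / l ^ 2 : ℚ)
        + ∑ l ∈ (Ioc 7 L).filter Nat.Prime, (2 / l ^ 2 : ℚ) := by
        rw [← sum_union_inter]
        exact le_add_of_nonneg_right (sum_nonneg fun _ _ => by positivity)
    _ ≤ _ := by
        rw [h2, sum_pair (by norm_num)]
        push_cast
        linarith

theorem margin_of_density {k r s u v π A B : ℚ} (hk : 166 ≤ k) (hr0 : 0 ≤ r)
    (hr : r ≤ 35 / 100 * k + 7 / 10) (hs : 0 < s) (hu : 0 ≤ u) (hu2 : 3 / (2 * r + 3) ≤ u ^ 2)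
    (huv : u / 3 ≤ v) (hπ : 100 * (k * π) ≤ 227 * s) (hA : 0 ≤ A) (hAs : 1000 * k ^ 2 * A ≤ 7 * s)
    (hB : B ≤ 24 * k) :
    π + A * B < s * (v * (1 - 6833 / 10000) - 1 / (10 * k)) := by
  have hk0 : 0 < k := by linarith
  have h1 : 25 / k ≤ u := by
    refine le_of_sq_le_sq ?_ hu
    refine le_trans ?_ hu2
    rw [div_pow, div_le_div_iff₀ (by positivity) (by positivity)]
    nlinarith
  have h2 : 25 / k * (3167 / 30000) ≤ v * (1 - 6833 / 10000) := by
    have := h1.trans (by linarith : u ≤ 3 * v)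
    linarith
  have h3 : π ≤ 227 / 100 * (s / k) := by
    rw [← mul_div_assoc, le_div_iff₀ hk0]; linarith
  have h4 : A * B ≤ 168 / 1000 * (s / k) := by
    rw [← mul_div_assoc, le_div_iff₀ hk0]
    have : A * B * k ≤ A * (24 * k) * k := by gcongr
    nlinarith
  have h5 : s * (25 / k * (3167 / 30000) - 1 / (10 * k))
      ≤ s * (v * (1 - 6833 / 10000) - 1 / (10 * k)) := by gcongr
  have h6 : s * (25 / k * (3167 / 30000) - 1 / (10 * k)) = (25 * 3167 / 30000 - 1 / 10) * (s / k) := by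
    field_simp
  have h7 : 0 < s / k := by positivity
  linarith

theorem exists_primitive_of_ten_pow_hundred_le {n : ℕ} (hlo : 10 ^ 100 ≤ n) :
    ∃ x : ℕ, x ^ 2 ≤ n ∧ x.Coprime n ∧ Squarefree (n - x ^ 2) := by
  have hn0 : n ≠ 0 := by omega
  set N := Nat.sqrt n with hN
  have hN1 : 2 ^ 166 ≤ N := Nat.le_sqrt'.2 (le_trans (by norm_num) hlo)
  have hN0 : N ≠ 0 := by have : 0 < 2 ^ 166 := by norm_num
                         omega
  set k := Nat.log 2 N with hk
  have hk166 : 166 ≤ k := by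
    rw [hk]; exact (Nat.le_log_iff_pow_le (by norm_num) hN0).2 hN1
  have hkN : 2 ^ k ≤ N := Nat.pow_log_le_self 2 hN0
  have hNk : N < 2 ^ (k + 1) := Nat.lt_pow_succ_log_self (by norm_num) N
  obtain ⟨j, hj1, hj2⟩ : ∃ j, 4 * k + 4 ≤ 5 * j ∧ 5 * j ≤ 4 * k + 8 :=
    ⟨(4 * k + 8) / 5, by omega, by omega⟩
  have hnX : n ^ 2 < (2 ^ j) ^ 5 := by
    have h1 : n < (2 ^ (k + 1)) ^ 2 :=
      (Nat.lt_succ_sqrt' n).trans_le (Nat.pow_le_pow_left hNk 2)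
    calc n ^ 2 < ((2 ^ (k + 1)) ^ 2) ^ 2 := Nat.pow_lt_pow_left h1 (by norm_num)
      _ = 2 ^ (4 * k + 4) := by ring
      _ ≤ 2 ^ (5 * j) := Nat.pow_le_pow_right (by norm_num) hj1
      _ = (2 ^ j) ^ 5 := by rw [← pow_mul, mul_comm]
  set T := n.primeFactors.filter (5 ≤ ·) with hT
  have hTp : ∀ q ∈ T, q.Prime ∧ 5 ≤ q ∧ q ∣ n := fun q hq =>
    have h := mem_filter.1 hq
    ⟨Nat.prime_of_mem_primeFactors h.1, h.2, Nat.dvd_of_mem_primeFactors h.1⟩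
  have hmod : ∀ q ∈ T, q % 2 = 1 ∧ q % 3 ≠ 0 := fun q hq => by
    obtain ⟨hq, h5, -⟩ := hTp q hq
    have h2 := (Nat.Prime.eq_one_or_self_of_dvd hq 2).mt (by omega)
    have h3 := (Nat.Prime.eq_one_or_self_of_dvd hq 3).mt (by omega)
    omega
  obtain ⟨S, hST, hSX, hSlt, hSq⟩ := exists_initial_segment T (X := 2 ^ j) Nat.one_le_two_pow
  set Q := T \ S with hQ
  have hr : 16 * S.card ≤ 7 * j := sixteen_mul_card_le (fun q hq => (hTp q (hST hq)).2.1) hSX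
  have hQT : ∀ q ∈ Q, q ∈ T := fun q hq => (mem_sdiff.1 hq).1
  have hprod : (∏ p ∈ S, p) * ∏ p ∈ Q, p ≤ n := by
    rw [mul_comm, hQ, prod_sdiff hST]
    exact Nat.le_of_dvd (Nat.pos_of_ne_zero hn0) ((prod_dvd_prod_of_subset _ _ _
      (filter_subset _ _)).trans (Nat.prod_primeFactors_dvd n))
  have htail : 2 * Q.card ≤ 3 * S.card + 4 ∧ ∑ q ∈ Q, (1 / q : ℚ) ≤ 1 / 2 := by
    rcases Q.eq_empty_or_nonempty with h | h
    · rw [h]; simp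
    obtain ⟨a, haQ, ha⟩ : ∃ a ∈ Q, ∀ q ∈ Q, a ≤ q := ⟨Q.min' h, Q.min'_mem h, fun q => Q.min'_le q⟩
    have haT := hTp a (hQT a haQ)
    have hcard := two_mul_card_tail_le hnX (fun p hp => (hSlt p hp a haQ).le) ha (hSq a haQ)
      (by omega) hprod
    refine ⟨hcard, ?_⟩
    have h3 := three_mul_card_le (A := insert a S) (a := a) fun q hq => by
      rcases mem_insert.1 hq with rfl | h
      · exact ⟨(hmod q (hQT q haQ)).1, (hmod q (hQT q haQ)).2, haT.2.1, le_rfl⟩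
      · exact ⟨(hmod q (hST h)).1, (hmod q (hST h)).2, (hTp q (hST h)).2.1, (hSlt q h a haQ).le⟩
    rw [card_insert_of_notMem (mem_sdiff.1 haQ).2] at h3
    have h4 : 2 * Q.card ≤ a := by
      have := (hmod a (hQT a haQ)).2
      omega
    have ha0 : (0 : ℚ) < a := by exact_mod_cast (by omega : 0 < a)
    calc ∑ q ∈ Q, (1 / q : ℚ) ≤ ∑ _q ∈ Q, (1 / a : ℚ) :=
          sum_le_sum fun q hq => one_div_le_one_div_of_le ha0 (by exact_mod_cast ha q hq)
      _ = Q.card / a := by rw [sum_const, nsmul_eq_mul, mul_one_div]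
      _ ≤ 1 / 2 := by
          rw [div_le_div_iff₀ ha0 (by norm_num)]
          exact_mod_cast (by omega : Q.card * 2 ≤ 1 * a)
  set F := (Icc 5 (10 * k)).filter (fun l => l.Prime ∧ ¬ l ∣ n) with hF
  have hFp : ∀ l ∈ F, l.Prime ∧ 5 ≤ l ∧ l ≤ 10 * k ∧ ¬ l ∣ n := fun l hl => by
    have h := mem_filter.1 hl
    have h' := mem_Icc.1 h.1
    exact ⟨h.2.1, h'.1, h'.2, h.2.2⟩
  have hFcard : F.card ≤ 10 * k - 4 := by
    refine (card_filter_le _ _).trans ?_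
    rw [Nat.card_Icc]; omega
  have hσ : ∑ p ∈ (Ioc (10 * k) N).filter Nat.Prime, (1 / p ^ 2 : ℚ) ≤ 1 / (10 * k) := by
    simpa using sum_inv_sq_primes_le (L := 10 * k) (M := 10 * k) (by omega) le_rfl N
  refine exists_primitive_of_sieve (y := N) (L := 10 * k) (S := S) (Q := Q) (F := F)
    (σ := 1 / (10 * k)) (R := 6833 / 10000) (fun q hq => hTp q (hST hq)) ?_ ?_ ?_ ?_ ?_ hσ ?_ ?_
  · exact fun q hq => ⟨(hTp q (hQT q hq)).1, (hTp q (hQT q hq)).2.1, (mem_sdiff.1 hq).2⟩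
  · exact fun p hp h5 hpn hpS => mem_sdiff.2
      ⟨mem_filter.2 ⟨Nat.mem_primeFactors.2 ⟨hp, hpn, hn0⟩, h5⟩, hpS⟩
  · exact fun l hl => ⟨(hFp l hl).1, (hFp l hl).2.1, (hFp l hl).2.2.2⟩
  · exact fun p hp h5 hpL hpn => mem_filter.2 ⟨mem_Icc.2 ⟨h5, hpL⟩, hp, hpn⟩
  · intro x p _ hx _ hd hpar
    simpa using prime_le_sqrt hx hpar hd
  · have := sum_two_div_sq_le (L := 10 * k) (F := F)
      fun l hl => ⟨(hFp l hl).1, (hFp l hl).2.1, (hFp l hl).2.2.1⟩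
    linarith [htail.2]
  · set d := if 3 ∣ n then 6 else 7 with hd
    have hd6 : 6 ≤ d ∧ d ≤ 7 := by rw [hd]; split_ifs <;> omega
    have hpred : ∏ q ∈ S, (q - 1) ≤ 2 ^ j := (prod_le_prod' fun q _ => Nat.sub_le q 1).trans hSX
    have hu : ((∏ q ∈ S, (q - 1) : ℕ) : ℚ) / (∏ q ∈ S, q : ℕ) = ∏ q ∈ S, (1 - 1 / q : ℚ) := by
      rw [Nat.cast_prod, Nat.cast_prod, ← prod_div_distrib]
      refine prod_congr rfl fun q hq => ?_
      have h5 := (hTp q (hST hq)).2.1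
      have hq0 : (q : ℚ) ≠ 0 := by exact_mod_cast (by omega : q ≠ 0)
      rw [Nat.cast_sub (by omega), one_sub_div hq0, Nat.cast_one]
    have hdens := three_div_le_sq_prod (A := S)
      fun q hq => ⟨(hmod q (hST hq)).1, (hTp q (hST hq)).2.1⟩
    rw [← hu] at hdens
    have hbig := two_pow_mul_le hk166 hj2
    have hlog := primeCounting_le_log (k := k) (y := N) (by omega) hkN
    refine margin_of_density (k := k) (r := S.card) (by exact_mod_cast hk166) (Nat.cast_nonneg _)
      ?_ (by exact_mod_cast Nat.pos_of_ne_zero hN0)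
      (div_nonneg (Nat.cast_nonneg _) (Nat.cast_nonneg _)) hdens ?_ (by exact_mod_cast hlog)
      (Nat.cast_nonneg _) ?_ ?_
    · have : (100 * S.card : ℚ) ≤ 35 * k + 70 := by
        exact_mod_cast (by omega : 100 * S.card ≤ 35 * k + 70)
      linarith
    · have hd' : (6 : ℚ) ≤ (d : ℕ) := by exact_mod_cast hd6.1
      rw [Nat.cast_mul, Nat.cast_mul, mul_div_mul_comm, div_eq_mul_one_div _ (3 : ℚ), mul_comm]
      refine mul_le_mul_of_nonneg_right ?_ (div_nonneg (Nat.cast_nonneg _) (Nat.cast_nonneg _))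
      push_cast
      linarith
    · have : 1000 * k ^ 2 * (d * ∏ q ∈ S, (q - 1)) ≤ 7 * N := by
        calc 1000 * k ^ 2 * (d * ∏ q ∈ S, (q - 1)) ≤ 1000 * k ^ 2 * (7 * 2 ^ j) :=
              Nat.mul_le_mul_left _ (Nat.mul_le_mul hd6.2 hpred)
          _ = 7 * (1000 * k ^ 2 * 2 ^ j) := by ring
          _ ≤ 7 * N := Nat.mul_le_mul_left _ (hbig.trans hkN)
      exact_mod_cast this
    · have : 1 + Q.card + 2 * F.card ≤ 24 * k := by
        have := htail.1
        omega
      exact_mod_cast this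

/-- The number with binary digits `1` at `0, s, 2 * s, …, (2 ^ j - 1) * s`. -/
def repeatBits (s : ℕ) : ℕ → ℕ
  | 0 => 1
  | j + 1 => repeatBits s j ||| (repeatBits s j <<< (s * 2 ^ j))

theorem testBit_repeatBits {s i : ℕ} (hi : s ∣ i) :
    ∀ j, i < s * 2 ^ j → (repeatBits s j).testBit i = true := by
  intro j
  induction j generalizing i with
  | zero =>
    intro h
    have : i = 0 := Nat.eq_zero_of_dvd_of_lt hi (by simpa using h)
    rw [this, repeatBits, Nat.testBit_one_zero]
  | succ j ih =>
    intro h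
    rw [repeatBits, Nat.testBit_or, Bool.or_eq_true, Nat.testBit_shiftLeft]
    rcases Nat.lt_or_ge i (s * 2 ^ j) with h' | h'
    · exact Or.inl (ih hi h')
    · right
      rw [Bool.and_eq_true]
      refine ⟨by simpa using h', ih (Nat.dvd_sub hi (dvd_mul_right _ _)) ?_⟩
      rw [pow_succ, ← mul_assoc] at h
      omega

/-- A number whose binary digit `i < M` is `1` whenever `s ∣ B + i`. -/
def multiplesMask (B M s : ℕ) : ℕ :=
  bif Nat.ble M ((s - B % s) % s) then 0
  else (bif Nat.ble M s then 1 else repeatBits s (Nat.log2 (M / s) + 1)) <<< ((s - B % s) % s)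

theorem testBit_multiplesMask {B M s i : ℕ} (hs : 0 < s) (hi : i < M) (h : s ∣ B + i) :
    (multiplesMask B M s).testBit i = true := by
  set r := (s - B % s) % s with hr
  have hmod : i % s = r := by
    have h1 : (B + i) % s = 0 := Nat.mod_eq_zero_of_dvd h
    have h2 : B % s < s := Nat.mod_lt _ hs
    have h3 : (B + (s - B % s)) % s = 0 := by
      have h5 : B + (s - B % s) = s * (B / s + 1) := by
        have := Nat.div_add_mod B s
        rw [Nat.mul_succ]
        omega
      rw [h5]
      exact Nat.mul_mod_right _ _
    have h4 : B + i ≡ B + (s - B % s) [MOD s] := h1.trans h3.symm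
    exact Nat.ModEq.add_left_cancel' B h4
  have hri : r ≤ i := by rw [← hmod]; exact Nat.mod_le _ _
  have hdvd : s ∣ i - r := by rw [← hmod]; exact Nat.dvd_sub_mod i
  rw [multiplesMask, ← hr]
  have h1 : Nat.ble M r = false := by
    rw [Bool.eq_false_iff, ne_eq, Nat.ble_eq]; omega
  rw [h1, cond_false, Nat.testBit_shiftLeft, Bool.and_eq_true]
  refine ⟨by simpa using hri, ?_⟩
  by_cases h2 : M ≤ s
  · rw [Nat.ble_eq_true_of_le h2, cond_true, Nat.eq_zero_of_dvd_of_lt hdvd (by omega),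
      Nat.testBit_one_zero]
  · have h3 : Nat.ble M s = false := by rw [Bool.eq_false_iff, ne_eq, Nat.ble_eq]; exact h2
    rw [h3, cond_false]
    refine testBit_repeatBits hdvd _ ?_
    have h4 : M / s < 2 ^ (Nat.log2 (M / s) + 1) := Nat.lt_log2_self
    have h5 : M < s * (M / s + 1) := Nat.lt_mul_div_succ M hs
    have h6 := Nat.mul_le_mul_left s h4
    have h7 : s * (M / s + 1) = s * (M / s).succ := rfl
    omega

/-- The bitwise disjunction of `multiplesMask B M s` over the members `s` of a list. -/
def unionMask (B M : ℕ) : List ℕ → ℕ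
  | [] => 0
  | s :: l => multiplesMask B M s ||| unionMask B M l

theorem testBit_unionMask {B M s i : ℕ} (hs : 0 < s) (hi : i < M) (h : s ∣ B + i) :
    ∀ l : List ℕ, s ∈ l → (unionMask B M l).testBit i = true := by
  intro l
  induction l with
  | nil => simp
  | cons a l ih =>
    intro hmem
    rw [unionMask, Nat.testBit_or, Bool.or_eq_true]
    rcases List.mem_cons.1 hmem with rfl | hmem
    · exact Or.inl (testBit_multiplesMask hs hi h)
    · exact Or.inr (ih hmem)

/-- Digit `i` is `1` whenever `B + i` fails, for each `x` in the list, to be coprime to `x` with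
`B + i - x ^ 2` squarefree; `V` marks the non-squarefree numbers. -/
def failureMask (B M V top : ℕ) : List ℕ → ℕ
  | [] => top
  | x :: l => ((V <<< (x * x)) |||
      unionMask B M ((List.range (x + 1)).filter fun d => Nat.ble 2 d && Nat.beq (x % d) 0)) &&&
      failureMask B M V top l

theorem exists_of_testBit_failureMask {B M V top i : ℕ} (ht : top.testBit i = true) :
    ∀ l : List ℕ, (failureMask B M V top l).testBit i = false → ∃ x ∈ l,
      (V <<< (x * x)).testBit i = false ∧ (unionMask B M ((List.range (x + 1)).filter
        fun d => Nat.ble 2 d && Nat.beq (x % d) 0)).testBit i = false := by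
  intro l
  induction l with
  | nil => intro h; rw [failureMask, ht] at h; exact absurd h (by simp)
  | cons x l ih =>
    intro h
    rw [failureMask, Nat.testBit_and, Bool.and_eq_false_iff, Nat.testBit_or,
      Bool.or_eq_false_iff] at h
    rcases h with h | h
    · exact ⟨x, by simp, h⟩
    · obtain ⟨y, hy, h⟩ := ih h
      exact ⟨y, by simp [hy], h⟩

/-- The squares of the primes up to `5000`; the modulus is the product of the primes up to `67`. -/
def primeSquares : List ℕ :=
  ((List.range 5001).filter fun p => Nat.beq (Nat.gcd p 7858321551080267055879090) 1 && Nat.blt 1 p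
    || (Nat.ble p 67 && Nat.blt 1 p)).map fun p => p * p

theorem sq_mem_primeSquares {p : ℕ} (hp : p.Prime) (h : p ≤ 5000) : p * p ∈ primeSquares := by
  refine List.mem_map.2 ⟨p, List.mem_filter.2 ⟨List.mem_range.2 (by omega), ?_⟩, rfl⟩
  rw [Bool.or_eq_true, Bool.and_eq_true, Bool.and_eq_true, Nat.beq_eq, Nat.ble_eq]
  have h1 : Nat.blt 1 p = true := by rw [Nat.blt_eq]; exact hp.one_lt
  by_cases h67 : p ≤ 67
  · exact Or.inr ⟨h67, h1⟩
  · refine Or.inl ⟨?_, h1⟩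
    change p.Coprime _
    rw [Nat.Prime.coprime_iff_not_dvd hp]
    intro hd
    have : 7858321551080267055879090 ∣ Nat.factorial 67 := by decide +kernel
    exact h67 (hp.dvd_factorial.1 (hd.trans this))

/-- A check that every `n` with `B + 441 ≤ n < B + 441 + K` has a representation with `x ≤ 21`. -/
def segmentCheck (B K : ℕ) : Bool :=
  Nat.beq (failureMask B (K + 441) (unionMask B (K + 441) primeSquares) ((2 ^ K - 1) <<< 441)
    (List.range' 1 21)) 0

theorem exists_primitive_of_segmentCheck {B K n : ℕ} (h : segmentCheck B K = true)
    (hB0 : 0 < B) (hB : B + 441 ≤ n) (hK : n < B + 441 + K) (hn : n ≤ 25 * 10 ^ 6) :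
    ∃ x : ℕ, x ^ 2 ≤ n ∧ x.Coprime n ∧ Squarefree (n - x ^ 2) := by
  obtain ⟨i, rfl⟩ : ∃ i, n = B + i := ⟨n - B, by omega⟩
  have htop : ((2 ^ K - 1) <<< 441).testBit i = true := by
    rw [Nat.testBit_shiftLeft, Nat.testBit_two_pow_sub_one, Bool.and_eq_true]
    simp only [ge_iff_le, decide_eq_true_eq]
    omega
  obtain ⟨x, hx, h1, h2⟩ := exists_of_testBit_failureMask htop (List.range' 1 21)
    (by rw [Nat.eq_of_beq_eq_true h]; exact Nat.zero_testBit i)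
  have hx21 : 1 ≤ x ∧ x ≤ 21 := by
    have := List.mem_range'_1.1 hx
    omega
  have hx2 : x * x ≤ 441 := Nat.mul_le_mul hx21.2 hx21.2
  have hxi : x * x ≤ i := (Nat.mul_le_mul hx21.2 hx21.2).trans (by omega)
  refine ⟨x, by rw [sq]; omega, ?_, ?_⟩
  · by_contra hco
    have hd := Nat.gcd_dvd_left x (B + i)
    have hd0 : 0 < Nat.gcd x (B + i) := Nat.gcd_pos_of_pos_left _ hx21.1
    refine absurd (testBit_unionMask (s := Nat.gcd x (B + i)) (B := B) (M := K + 441) (i := i) hd0 (by omega)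
      (Nat.gcd_dvd_right _ _) _ ?_) (by rw [h2]; exact Bool.false_ne_true)
    refine List.mem_filter.2 ⟨List.mem_range.2 ?_, ?_⟩
    · exact Nat.lt_succ_of_le (Nat.le_of_dvd hx21.1 hd)
    · rw [Bool.and_eq_true, Nat.ble_eq, Nat.beq_eq]
      have : Nat.gcd x (B + i) ≠ 1 := hco
      exact ⟨by omega, Nat.mod_eq_zero_of_dvd hd⟩
  · rw [Nat.squarefree_iff_prime_squarefree]
    intro p hp hdvd
    rw [sq] at hdvd
    have hle : p * p ≤ B + i - x * x := Nat.le_of_dvd (by omega) hdvd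
    have hp5 : p ≤ 5000 := by
      by_contra! h
      have := Nat.mul_le_mul h h
      omega
    rw [Nat.testBit_shiftLeft, Bool.and_eq_false_iff] at h1
    rcases h1 with h1 | h1
    · simp only [ge_iff_le, decide_eq_false_iff_not] at h1
      omega
    · refine absurd (testBit_unionMask (s := p * p) (B := B) (M := K + 441) (i := i - x * x)
        (Nat.mul_pos hp.pos hp.pos) (by omega) ?_ _ (sq_mem_primeSquares hp hp5))
        (by rw [h1]; exact Bool.false_ne_true)
      rwa [← Nat.add_sub_assoc hxi]

theorem segmentCheck_of_lt_twelve {m : ℕ} (hm : m < 12) :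
    segmentCheck (1374637 + m * 2 ^ 21) (2 ^ 21) = true := by
  interval_cases m <;> decide +kernel

theorem exists_primitive_of_le_twenty_five_million {n : ℕ} (hlo : 1375078 ≤ n)
    (hhi : n ≤ 25 * 10 ^ 6) : ∃ x : ℕ, x ^ 2 ≤ n ∧ x.Coprime n ∧ Squarefree (n - x ^ 2) :=
  exists_primitive_of_segmentCheck
    (segmentCheck_of_lt_twelve (m := (n - 1375078) / 2 ^ 21) (by omega))
    (by omega) (by omega) (by omega) hhi

theorem exists_primitive {n : ℕ} (hn : 1375078 ≤ n) :
    ∃ x : ℕ, x ^ 2 ≤ n ∧ x.Coprime n ∧ Squarefree (n - x ^ 2) := by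
  rcases Nat.le_total n (25 * 10 ^ 6) with h1 | h1
  · exact exists_primitive_of_le_twenty_five_million hn h1
  rcases Nat.le_total n (7 * 10 ^ 8) with h2 | h2
  · exact exists_primitive_of_le_seven_hundred_million h1 h2
  rcases Nat.le_total n (8 * 10 ^ 16) with h3 | h3
  · exact exists_primitive_of_le_eight_pow_sixteen h2 h3
  rcases Nat.le_total n (10 ^ 100) with h4 | h4
  · exact exists_primitive_of_le_ten_pow_hundred h3 h4
  · exact exists_primitive_of_ten_pow_hundred_le h4

theorem primitive_rep_exists (n : ℕ) (hn : 1375078 ≤ n) :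
    (∃ x : ℕ, x ^ 2 ≤ n ∧ Nat.gcd x n = 1 ∧ Squarefree (n - x ^ 2)) ∧
    0 < {x : ℕ | x ^ 2 ≤ n ∧ Nat.gcd x n = 1 ∧ Squarefree (n - x ^ 2)}.ncard := by
  obtain ⟨x, hx⟩ := exists_primitive hn
  refine ⟨⟨x, hx⟩, (Set.ncard_pos ((Set.finite_Iic n).subset fun y hy => ?_)).2 ⟨x, hx⟩⟩
  exact (Nat.le_self_pow two_ne_zero y).trans hy.1
end
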